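/- arXiv:2506.24054 — 6 statements merged into one kernel-verified Lean document; each statement's English description precedes it below -/
import Mathlib

section
/- Smolyak's algorithm admits the combination-technique representation: for every dimension d ≥ 1, every resolution q ≥ d, every f ∈ C([0,1]^d) and every x ∈ [0,1]^d, Sm(q,d)(f)(x) = Σ_{𝐢 ∈ ℕ^d, i_k ≥ 1, q−d+1 ≤ ‖𝐢‖₁ ≤ q} (−1)^{q−‖𝐢‖₁} · binom(d−1, q−‖𝐢‖₁) · (U^{i_1} ⊗ ⋯ ⊗ U^{i_d})(f)(x). -/
noncomputable section

/-- The univariate interpolation operator `U^i(f) = Σ_j f(x^i_j)·a^i_j`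
(with `U^0 = 0`, enforced by `m 0 = 0`). -/
def Uop (m : ℕ → ℕ) (pts : ℕ → ℕ → ℝ) (a : ℕ → ℕ → ℝ → ℝ) (i : ℕ) (f : ℝ → ℝ) : ℝ → ℝ :=
  fun t => ∑ j ∈ Finset.range (m i), f (pts i j) * a i j t

/-- The tensor-product operator `U^{i₁} ⊗ ⋯ ⊗ U^{i_d}`; if some `ι k = 0` then
`m 0 = 0` makes the whole sum (and hence the operator) zero. -/
def Utensor (m : ℕ → ℕ) (pts : ℕ → ℕ → ℝ) (a : ℕ → ℕ → ℝ → ℝ) (d : ℕ)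
    (ι : Fin d → ℕ) (f : (Fin d → ℝ) → ℝ) : (Fin d → ℝ) → ℝ :=
  fun y => ∑ j ∈ Fintype.piFinset (fun k => Finset.range (m (ι k))),
    f (fun k => pts (ι k) (j k)) * ∏ k, a (ι k) (j k) (y k)

/-- The tensor product of difference operators `Δ^{i₁} ⊗ ⋯ ⊗ Δ^{i_d}` with
`Δ^i = U^i − U^{i−1}`, expanded multilinearly. -/
def Dtensor (m : ℕ → ℕ) (pts : ℕ → ℕ → ℝ) (a : ℕ → ℕ → ℝ → ℝ) (d : ℕ)
    (ι : Fin d → ℕ) (f : (Fin d → ℝ) → ℝ) : (Fin d → ℝ) → ℝ :=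
  fun y => ∑ ε : Fin d → Bool,
    (-1 : ℝ) ^ (∑ k, (if ε k then 1 else 0 : ℕ)) *
      Utensor m pts a d (fun k => ι k - (if ε k then 1 else 0)) f y

/-- Smolyak's algorithm `Sm(q,d) = Σ_{𝐢 ≥ 1, ‖𝐢‖₁ ≤ q} Δ^{i₁} ⊗ ⋯ ⊗ Δ^{i_d}`. -/
def Smolyak (m : ℕ → ℕ) (pts : ℕ → ℕ → ℝ) (a : ℕ → ℕ → ℝ → ℝ) (q d : ℕ)
    (f : (Fin d → ℝ) → ℝ) : (Fin d → ℝ) → ℝ :=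
  fun y => ∑ ι ∈ (Fintype.piFinset fun _ : Fin d => Finset.Icc 1 q).filter
      (fun ι => ∑ k, ι k ≤ q), Dtensor m pts a d ι f y

/-- Summing a function of the number of `true` values over all Boolean vectors. -/
theorem sum_bool_apply_card {κ M : Type*} [Fintype κ] [DecidableEq κ] [AddCommMonoid M]
    (F : ℕ → M) :
    ∑ ε : κ → Bool, F (∑ k, if ε k then 1 else 0) =
      ∑ n ∈ Finset.range (Fintype.card κ + 1), (Fintype.card κ).choose n • F n := by
  rw [← Finset.card_univ, ← Finset.sum_powerset_apply_card, Finset.powerset_univ]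
  refine Finset.sum_bij' (fun ε _ => Finset.univ.filter fun k => ε k = true)
    (fun s _ k => decide (k ∈ s)) ?_ ?_ ?_ ?_ ?_
  · simp
  · simp
  · intro ε _
    simp
  · intro s _
    simp
  · intro ε _
    simp

/-- The truncated alternating sum over Boolean vectors is a signed binomial coefficient. -/
theorem sum_bool_neg_one_pow_card_le {d : ℕ} (hd : 1 ≤ d) (N : ℕ) :
    ∑ ε : Fin d → Bool, (if (∑ k, if ε k then 1 else 0) ≤ N
      then (-1 : ℝ) ^ (∑ k, if ε k then 1 else 0) else 0) =
      (-1) ^ N * ((d - 1).choose N : ℝ) := by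
  obtain ⟨n, rfl⟩ : ∃ n, d = n + 1 := ⟨d - 1, by omega⟩
  rw [sum_bool_apply_card fun j => if j ≤ N then (-1 : ℝ) ^ j else 0, Fintype.card_fin]
  have h := congrArg (Int.cast : ℤ → ℝ)
    (Int.alternating_sum_range_choose_eq_choose (n := n) (m := N))
  push_cast at h
  rw [Nat.add_sub_cancel, ← h]
  refine Finset.sum_bij_ne_zero (fun j _ _ => j) ?_ ?_ ?_ ?_
  · intro j _ hj
    simp only [Finset.mem_range]
    by_contra hjN
    exact hj (by simp [show ¬ j ≤ N by omega])
  · intros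
    assumption
  · intro j hj hj0
    have hjN : j ≤ N := by simpa [Nat.lt_succ_iff] using hj
    have hjn : j < n + 1 + 1 := by
      by_contra hlt
      exact hj0 (by simp [Nat.choose_eq_zero_of_lt (show n + 1 < j by omega)])
    refine ⟨j, Finset.mem_range.2 hjn, ?_, rfl⟩
    simpa [hjN, mul_comm] using hj0
  · intro j _ hj
    have hjN : j ≤ N := by
      by_contra hjN
      exact hj (by simp [hjN])
    simp [hjN, mul_comm]

/-- Shifting the index of a sum over the multi-indices `ι ≥ 1` with `‖ι‖₁ ≤ q`, for a summand that
vanishes as soon as one entry of the multi-index is zero. -/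
theorem sum_multiIndex_sub {κ M : Type*} [Fintype κ] [DecidableEq κ] [AddCommMonoid M]
    {g : (κ → ℕ) → M} (hg : ∀ ι k, ι k = 0 → g ι = 0) (q : ℕ) (e : κ → ℕ) :
    ∑ ι ∈ (Fintype.piFinset fun _ : κ => Finset.Icc 1 q).filter (fun ι => ∑ k, ι k ≤ q),
        g (fun k => ι k - e k) =
      ∑ ι ∈ (Fintype.piFinset fun _ : κ => Finset.Icc 1 q).filter (fun ι => ∑ k, ι k ≤ q),
        if ∑ k, e k ≤ q - ∑ k, ι k then g ι else 0 := by
  have pos_of_ne : ∀ ι : κ → ℕ, g ι ≠ 0 → ∀ k, 1 ≤ ι k := fun ι h k =>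
    Nat.one_le_iff_ne_zero.2 fun h0 => h (hg ι k h0)
  have sum_sub_add : ∀ ι : κ → ℕ, g (fun k => ι k - e k) ≠ 0 →
      ∑ k, (ι k - e k) + ∑ k, e k = ∑ k, ι k := fun ι h => by
    rw [← Finset.sum_add_distrib]
    refine Finset.sum_congr rfl fun k _ => ?_
    have := pos_of_ne _ h k
    omega
  refine Finset.sum_bij_ne_zero (fun ι _ _ k => ι k - e k) ?_ ?_ ?_ ?_
  · intro ι hι h
    simp only [Finset.mem_filter, Fintype.mem_piFinset, Finset.mem_Icc] at hι ⊢
    have hs := sum_sub_add ι h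
    refine ⟨fun k => ⟨pos_of_ne _ h k, ?_⟩, by omega⟩
    have := (hι.1 k).2
    omega
  · intro ι₁ _ h₁ ι₂ _ h₂ h
    funext k
    have hk := congrFun h k
    have hk₁ := pos_of_ne _ h₁ k
    have hk₂ := pos_of_ne _ h₂ k
    omega
  · intro ι hι h
    simp only [Finset.mem_filter, Fintype.mem_piFinset, Finset.mem_Icc] at hι
    obtain ⟨hle, h0⟩ : ∑ k, e k ≤ q - ∑ k, ι k ∧ g ι ≠ 0 := by simpa using h
    have hsum : ∑ k, (ι k + e k) ≤ q := by
      rw [Finset.sum_add_distrib]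
      omega
    refine ⟨fun k => ι k + e k, ?_, by simpa using h0, by simp⟩
    simp only [Finset.mem_filter, Fintype.mem_piFinset, Finset.mem_Icc]
    refine ⟨fun k => ⟨(hι.1 k).1.trans (Nat.le_add_right _ _), ?_⟩, hsum⟩
    exact (Finset.single_le_sum (f := fun k => ι k + e k) (fun _ _ => Nat.zero_le _)
      (Finset.mem_univ k)).trans hsum
  · intro ι hι h
    have hs := sum_sub_add ι h
    have hq := (Finset.mem_filter.1 hι).2
    rw [if_pos (show ∑ k, e k ≤ q - ∑ k, (ι k - e k) by omega)]

theorem Utensor_eq_zero {m : ℕ → ℕ} (hm0 : m 0 = 0) (pts : ℕ → ℕ → ℝ) (a : ℕ → ℕ → ℝ → ℝ) {d : ℕ}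
    {ι : Fin d → ℕ} {k : Fin d} (hk : ι k = 0) (f : (Fin d → ℝ) → ℝ) (y : Fin d → ℝ) :
    Utensor m pts a d ι f y = 0 := by
  have : Fintype.piFinset (fun k => Finset.range (m (ι k))) = ∅ :=
    Fintype.piFinset_eq_empty.2 ⟨k, by simp [hk, hm0]⟩
  simp [Utensor, this]

/-- the combination-technique representation of Smolyak's algorithm. -/
theorem smolyak_combination_technique
    (m : ℕ → ℕ) (pts : ℕ → ℕ → ℝ) (a : ℕ → ℕ → ℝ → ℝ)
    (hm0 : m 0 = 0)
    (hpts : ∀ i, 1 ≤ i → ∀ j < m i, pts i j ∈ Set.Icc (0 : ℝ) 1)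
    (hdist : ∀ i, 1 ≤ i → ∀ j < m i, ∀ k < m i, pts i j = pts i k → j = k)
    (hacont : ∀ i j, Continuous (a i j))
    (hdelta : ∀ i, 1 ≤ i → ∀ j < m i, ∀ k < m i,
      a i j (pts i k) = if j = k then 1 else 0)
    (d q : ℕ) (hd : 1 ≤ d) (hq : d ≤ q)
    (f : (Fin d → ℝ) → ℝ) (hf : ContinuousOn f (Set.Icc (0 : Fin d → ℝ) 1))
    (x : Fin d → ℝ) (hx : x ∈ Set.Icc (0 : Fin d → ℝ) 1) :
    Smolyak m pts a q d f x =
      ∑ ι ∈ (Fintype.piFinset fun _ : Fin d => Finset.Icc 1 q).filter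
          (fun ι => q - d + 1 ≤ ∑ k, ι k ∧ ∑ k, ι k ≤ q),
        (-1 : ℝ) ^ (q - ∑ k, ι k) * ((d - 1).choose (q - ∑ k, ι k) : ℝ) *
          Utensor m pts a d ι f x := by
  simp only [Smolyak, Dtensor]
  rw [Finset.sum_comm]
  simp only [← Finset.mul_sum]
  have shift := fun ε : Fin d → Bool => sum_multiIndex_sub
    (g := fun ι => Utensor m pts a d ι f x) (fun ι k hk => Utensor_eq_zero hm0 pts a hk f x) q
    (fun k => if ε k then 1 else 0)
  simp only [shift, Finset.mul_sum]
  rw [Finset.sum_comm]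
  have coeff : ∀ ι : Fin d → ℕ,
      (∑ ε : Fin d → Bool, (-1 : ℝ) ^ (∑ k, if ε k then 1 else 0) *
        if (∑ k, if ε k then 1 else 0) ≤ q - ∑ k, ι k then Utensor m pts a d ι f x else 0) =
      (-1 : ℝ) ^ (q - ∑ k, ι k) * ((d - 1).choose (q - ∑ k, ι k) : ℝ) *
        Utensor m pts a d ι f x := fun ι => by
    rw [← sum_bool_neg_one_pow_card_le hd, Finset.sum_mul]
    simp only [mul_ite, ite_mul, mul_zero, zero_mul]
  simp only [coeff]
  symm
  refine Finset.sum_subset (Finset.monotone_filter_right _ fun ι _ h => h.2) fun ι hι h => ?_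
  have hlt : d - 1 < q - ∑ k, ι k := by
    simp only [Finset.mem_filter] at hι h
    by_contra hlt
    exact h ⟨hι.1, by omega, hι.2⟩
  simp [Nat.choose_eq_zero_of_lt hlt]
end
end

section
/- If the univariate point sets are nested, X_1 ⊆ X_2 ⊆ X_3 ⊆ …, then Smolyak's algorithm is interpolatory on the sparse grid: for every d ≥ 1, every q ≥ d, every g ∈ C([0,1]^d) and every x ∈ H(q,d), one has Sm(q,d)(g)(x) = g(x). -/
noncomputable section

/-- The sparse grid `H(q,d)`. -/
def sparseGrid (m : ℕ → ℕ) (pts : ℕ → ℕ → ℝ) (q d : ℕ) : Set (Fin d → ℝ) :=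
  {y | ∃ ι : Fin d → ℕ, (∀ k, 1 ≤ ι k) ∧ q - d + 1 ≤ ∑ k, ι k ∧ (∑ k, ι k ≤ q) ∧
    ∀ k, ∃ j < m (ι k), y k = pts (ι k) j}

/-- The weight that the value at the node `s` carries in `U^i(f)(t)`. -/
def nodeWeight (m : ℕ → ℕ) (pts : ℕ → ℕ → ℝ) (a : ℕ → ℕ → ℝ → ℝ) (t : ℝ) (i : ℕ) (s : ℝ) : ℝ :=
  ∑ j ∈ Finset.range (m i), if pts i j = s then a i j t else 0

/-- The finite set of all nodes of level at most `q`. -/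
def nodesUpTo (m : ℕ → ℕ) (pts : ℕ → ℕ → ℝ) (q : ℕ) : Finset ℝ :=
  (Finset.range (q + 1)).biUnion fun i => (Finset.range (m i)).image (pts i)

lemma nodeWeight_zero (m : ℕ → ℕ) (pts : ℕ → ℕ → ℝ) (a : ℕ → ℕ → ℝ → ℝ) (hm0 : m 0 = 0)
    (t s : ℝ) : nodeWeight m pts a t 0 s = 0 := by
  simp [nodeWeight, hm0]

lemma nodeWeight_of_mem (m : ℕ → ℕ) (pts : ℕ → ℕ → ℝ) (a : ℕ → ℕ → ℝ → ℝ)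
    (hdelta : ∀ i, 1 ≤ i → ∀ j < m i, ∀ k < m i, a i j (pts i k) = if j = k then 1 else 0)
    {i : ℕ} (hi : 1 ≤ i) {t : ℝ} (ht : ∃ j < m i, t = pts i j) (s : ℝ) :
    nodeWeight m pts a t i s = if s = t then 1 else 0 := by
  obtain ⟨j, hj, rfl⟩ := ht
  rw [nodeWeight, Finset.sum_eq_single j]
  · simp [hdelta i hi j hj j hj, eq_comm]
  · intro k hk hkj
    simp [hdelta i hi k (Finset.mem_range.1 hk) j hj, hkj]
  · intro h
    exact absurd (Finset.mem_range.2 hj) h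

lemma exists_node_of_le (m : ℕ → ℕ) (pts : ℕ → ℕ → ℝ)
    (hnested : ∀ i, 1 ≤ i → ∀ j < m i, ∃ j' < m (i + 1), pts (i + 1) j' = pts i j)
    {p i : ℕ} (hp : 1 ≤ p) (hpi : p ≤ i) {t : ℝ} (ht : ∃ j < m p, t = pts p j) :
    ∃ j < m i, t = pts i j := by
  induction i, hpi using Nat.le_induction with
  | base => exact ht
  | succ n hn ih =>
    obtain ⟨j, hj, rfl⟩ := ih
    obtain ⟨j', hj', h⟩ := hnested n (hp.trans hn) j hj
    exact ⟨j', hj', h.symm⟩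

lemma Utensor_eq_sum_nodeWeight (m : ℕ → ℕ) (pts : ℕ → ℕ → ℝ) (a : ℕ → ℕ → ℝ → ℝ) (d q : ℕ)
    (ι : Fin d → ℕ) (hι : ∀ k, ι k ≤ q) (f : (Fin d → ℝ) → ℝ) (x : Fin d → ℝ) :
    Utensor m pts a d ι f x = ∑ y ∈ Fintype.piFinset fun _ : Fin d => nodesUpTo m pts q,
      f y * ∏ k, nodeWeight m pts a (x k) (ι k) (y k) := by
  simp only [Utensor, nodeWeight, Finset.prod_univ_sum, Finset.mul_sum]
  rw [Finset.sum_comm]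
  refine Finset.sum_congr rfl fun j hj => ?_
  rw [Finset.sum_eq_single fun k => pts (ι k) (j k)]
  · simp
  · intro y _ hy
    obtain ⟨k, hk⟩ := Function.ne_iff.1 hy
    rw [Finset.prod_eq_zero (Finset.mem_univ k) (if_neg (Ne.symm hk)), mul_zero]
  · intro h
    refine absurd (Fintype.mem_piFinset.2 fun k => ?_) h
    simp only [nodesUpTo, Finset.mem_biUnion, Finset.mem_image]
    exact ⟨ι k, Finset.mem_range.2 (Nat.lt_succ_of_le (hι k)), j k,
      Fintype.mem_piFinset.1 hj k, rfl⟩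

lemma Dtensor_eq_sum_nodeWeight (m : ℕ → ℕ) (pts : ℕ → ℕ → ℝ) (a : ℕ → ℕ → ℝ → ℝ) (d q : ℕ)
    (ι : Fin d → ℕ) (hι : ∀ k, ι k ≤ q) (f : (Fin d → ℝ) → ℝ) (x : Fin d → ℝ) :
    Dtensor m pts a d ι f x = ∑ y ∈ Fintype.piFinset fun _ : Fin d => nodesUpTo m pts q,
      f y * ∏ k, (nodeWeight m pts a (x k) (ι k) (y k)
        - nodeWeight m pts a (x k) (ι k - 1) (y k)) := by
  have expand (y : Fin d → ℝ) :
      ∏ k, (nodeWeight m pts a (x k) (ι k) (y k) - nodeWeight m pts a (x k) (ι k - 1) (y k)) =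
      ∑ ε : Fin d → Bool, (-1 : ℝ) ^ (∑ k, (if ε k then 1 else 0 : ℕ)) *
        ∏ k, nodeWeight m pts a (x k) (ι k - (if ε k then 1 else 0)) (y k) := by
    simp only [← Finset.prod_pow_eq_pow_sum, ← Finset.prod_mul_distrib]
    rw [← Fintype.piFinset_univ, ← Finset.prod_univ_sum (fun _ => Finset.univ)
      (fun k (b : Bool) => (-1 : ℝ) ^ (if b then 1 else 0 : ℕ) *
        nodeWeight m pts a (x k) (ι k - (if b then 1 else 0)) (y k))]
    refine Finset.prod_congr rfl fun k _ => ?_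
    simp only [Fintype.sum_bool, if_true, Bool.false_eq_true, if_false, pow_one, pow_zero,
      Nat.sub_zero]
    ring
  simp only [Dtensor, expand, Finset.mul_sum]
  rw [Finset.sum_comm]
  refine Finset.sum_congr rfl fun ε _ => ?_
  rw [Utensor_eq_sum_nodeWeight m pts a d q _ (fun k => (Nat.sub_le _ _).trans (hι k)),
    Finset.mul_sum]
  exact Finset.sum_congr rfl fun y _ => by ring

lemma sum_Icc_one_sub_pred (w : ℕ → ℝ) (p : ℕ) :
    ∑ i ∈ Finset.Icc 1 p, (w i - w (i - 1)) = w p - w 0 := by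
  induction p with
  | zero => simp
  | succ n ih =>
    rw [Finset.sum_Icc_succ_top (Nat.le_add_left 1 n), ih]
    simp

/-- with nested univariate point sets, Smolyak's algorithm is
interpolatory on the sparse grid. -/
theorem smolyak_interpolatory_on_sparse_grid
    (m : ℕ → ℕ) (pts : ℕ → ℕ → ℝ) (a : ℕ → ℕ → ℝ → ℝ)
    (hm0 : m 0 = 0)
    (hpts : ∀ i, 1 ≤ i → ∀ j < m i, pts i j ∈ Set.Icc (0 : ℝ) 1)
    (hdist : ∀ i, 1 ≤ i → ∀ j < m i, ∀ k < m i, pts i j = pts i k → j = k)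
    (hacont : ∀ i j, Continuous (a i j))
    (hdelta : ∀ i, 1 ≤ i → ∀ j < m i, ∀ k < m i,
      a i j (pts i k) = if j = k then 1 else 0)
    (hnested : ∀ i, 1 ≤ i → ∀ j < m i, ∃ j' < m (i + 1), pts (i + 1) j' = pts i j)
    (d q : ℕ) (hd : 1 ≤ d) (hq : d ≤ q)
    (g : (Fin d → ℝ) → ℝ) (hg : ContinuousOn g (Set.Icc (0 : Fin d → ℝ) 1))
    (x : Fin d → ℝ) (hx : x ∈ sparseGrid m pts q d) :
    Smolyak m pts a q d g x = g x := by
  obtain ⟨p, hp1, -, hpq, hpx⟩ := hx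
  have hp_le (k : Fin d) : p k ≤ q :=
    (Finset.single_le_sum (fun _ _ => Nat.zero_le _) (Finset.mem_univ k)).trans hpq
  have weight_eq (k : Fin d) {i : ℕ} (hi : p k ≤ i) (s : ℝ) :
      nodeWeight m pts a (x k) i s = if s = x k then 1 else 0 :=
    nodeWeight_of_mem m pts a hdelta ((hp1 k).trans hi)
      (exists_node_of_le m pts hnested (hp1 k) hi (hpx k)) s
  have restrict : Smolyak m pts a q d g x =
      ∑ ι ∈ Fintype.piFinset fun k => Finset.Icc 1 (p k), Dtensor m pts a d ι g x := by
    refine (Finset.sum_subset (fun ι hι => ?_) fun ι hι hιp => ?_).symm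
    · have h k := Finset.mem_Icc.1 (Fintype.mem_piFinset.1 hι k)
      refine Finset.mem_filter.2 ⟨Fintype.mem_piFinset.2 fun k =>
        Finset.mem_Icc.2 ⟨(h k).1, (h k).2.trans (hp_le k)⟩, ?_⟩
      exact (Finset.sum_le_sum fun k _ => (h k).2).trans hpq
    · have h k := Finset.mem_Icc.1 (Fintype.mem_piFinset.1 (Finset.mem_filter.1 hι).1 k)
      obtain ⟨k, hk⟩ : ∃ k, p k < ι k := by
        by_contra! hle
        exact hιp (Fintype.mem_piFinset.2 fun k => Finset.mem_Icc.2 ⟨(h k).1, hle k⟩)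
      rw [Dtensor_eq_sum_nodeWeight m pts a d q ι fun k => (h k).2]
      refine Finset.sum_eq_zero fun y _ => ?_
      rw [Finset.prod_eq_zero (Finset.mem_univ k), mul_zero]
      rw [weight_eq k hk.le, weight_eq k (Nat.le_sub_one_of_lt hk), sub_self]
  have telescope (y : Fin d → ℝ) :
      ∑ ι ∈ Fintype.piFinset fun k => Finset.Icc 1 (p k),
        ∏ k, (nodeWeight m pts a (x k) (ι k) (y k) - nodeWeight m pts a (x k) (ι k - 1) (y k)) =
      ∏ k, nodeWeight m pts a (x k) (p k) (y k) := by
    rw [← Finset.prod_univ_sum (fun k => Finset.Icc 1 (p k)) (fun k i =>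
      nodeWeight m pts a (x k) i (y k) - nodeWeight m pts a (x k) (i - 1) (y k))]
    refine Finset.prod_congr rfl fun k _ => ?_
    rw [sum_Icc_one_sub_pred (fun i => nodeWeight m pts a (x k) i (y k)),
      nodeWeight_zero m pts a hm0, sub_zero]
  rw [restrict, Finset.sum_congr rfl fun ι hι =>
    Dtensor_eq_sum_nodeWeight m pts a d q ι (fun k =>
      (Finset.mem_Icc.1 (Fintype.mem_piFinset.1 hι k)).2.trans (hp_le k)) g x, Finset.sum_comm]
  simp only [← Finset.mul_sum, telescope]
  rw [Finset.sum_eq_single x]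
  · simp [weight_eq]
  · intro y _ hy
    obtain ⟨k, hk⟩ := Function.ne_iff.1 hy
    rw [Finset.prod_eq_zero (Finset.mem_univ k), mul_zero]
    rw [weight_eq k le_rfl, if_neg hk]
  · intro h
    refine absurd (Fintype.mem_piFinset.2 fun k => ?_) h
    obtain ⟨j, hj, hxj⟩ := hpx k
    simp only [nodesUpTo, Finset.mem_biUnion, Finset.mem_image]
    exact ⟨p k, Finset.mem_range.2 (Nat.lt_succ_of_le (hp_le k)), j,
      Finset.mem_range.2 hj, hxj.symm⟩
end
end

section
/- Suppose each univariate operator U^i reproduces all polynomials of degree at most m_i − 1, i.e., U^i(p)(x) = p(x) for all x ∈ [0,1] whenever p is a polynomial with deg p ≤ m_i − 1. Then Smolyak's algorithm Sm(q,d) is exact on the polynomial space E(q,d): for every multi-index α ∈ ℕ_0^d for which there exists 𝐢 ∈ ℕ^d with i_k ≥ 1, ‖𝐢‖₁ = q and α_k ≤ m_{i_k} − 1 for all k, the monomial x ↦ x_1^{α_1}⋯x_d^{α_d} is reproduced exactly by Sm(q,d) on [0,1]^d; consequently Sm(q,d)(g) = g on [0,1]^d for every g in the span E(q,d) of all such monomials.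 -/
noncomputable section

theorem Utensor_prod (m : ℕ → ℕ) (pts : ℕ → ℕ → ℝ) (a : ℕ → ℕ → ℝ → ℝ)
    {d : ℕ} (ι : Fin d → ℕ) (f : Fin d → ℝ → ℝ) (x : Fin d → ℝ) :
    Utensor m pts a d ι (fun y => ∏ k, f k (y k)) x = ∏ k, Uop m pts a (ι k) (f k) (x k) := by
  simp only [Utensor, Uop, Finset.prod_univ_sum, Finset.prod_mul_distrib]

theorem Dtensor_prod (m : ℕ → ℕ) (pts : ℕ → ℕ → ℝ) (a : ℕ → ℕ → ℝ → ℝ)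
    {d : ℕ} (ι : Fin d → ℕ) (f : Fin d → ℝ → ℝ) (x : Fin d → ℝ) :
    Dtensor m pts a d ι (fun y => ∏ k, f k (y k)) x =
      ∏ k, (Uop m pts a (ι k) (f k) (x k) - Uop m pts a (ι k - 1) (f k) (x k)) := by
  have h (k : Fin d) : Uop m pts a (ι k) (f k) (x k) - Uop m pts a (ι k - 1) (f k) (x k) =
      ∑ b : Bool, (-1 : ℝ) ^ (if b then 1 else 0 : ℕ) *
        Uop m pts a (ι k - (if b then 1 else 0)) (f k) (x k) := by
    simp [sub_eq_neg_add]
  simp only [h, Finset.prod_univ_sum, Fintype.piFinset_univ, Dtensor, Utensor_prod,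
    Finset.prod_mul_distrib, Finset.prod_pow_eq_pow_sum]

theorem Uop_zero_index (m : ℕ → ℕ) (pts : ℕ → ℕ → ℝ) (a : ℕ → ℕ → ℝ → ℝ)
    (hm0 : m 0 = 0) (f : ℝ → ℝ) (t : ℝ) : Uop m pts a 0 f t = 0 := by
  simp [Uop, hm0]

theorem Smolyak_zero (m : ℕ → ℕ) (pts : ℕ → ℕ → ℝ) (a : ℕ → ℕ → ℝ → ℝ)
    (q d : ℕ) (x : Fin d → ℝ) : Smolyak m pts a q d 0 x = 0 := by
  simp [Smolyak, Dtensor, Utensor]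

theorem Smolyak_add (m : ℕ → ℕ) (pts : ℕ → ℕ → ℝ) (a : ℕ → ℕ → ℝ → ℝ)
    (q d : ℕ) (f g : (Fin d → ℝ) → ℝ) (x : Fin d → ℝ) :
    Smolyak m pts a q d (f + g) x = Smolyak m pts a q d f x + Smolyak m pts a q d g x := by
  simp only [Smolyak, Dtensor, Utensor, Pi.add_apply, add_mul, mul_add, Finset.sum_add_distrib]

theorem Smolyak_smul (m : ℕ → ℕ) (pts : ℕ → ℕ → ℝ) (a : ℕ → ℕ → ℝ → ℝ)
    (q d : ℕ) (c : ℝ) (f : (Fin d → ℝ) → ℝ) (x : Fin d → ℝ) :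
    Smolyak m pts a q d (c • f) x = c * Smolyak m pts a q d f x := by
  simp only [Smolyak, Dtensor, Utensor, Pi.smul_apply, smul_eq_mul, mul_assoc, Finset.mul_sum,
    mul_left_comm c]

/-- A product function is reproduced at `x` as soon as each factor `f k` is reproduced at `x k` by
all univariate operators of index at least `s k`, where `∑ k, s k ≤ q`. -/
theorem Smolyak_prod_eq (m : ℕ → ℕ) (pts : ℕ → ℕ → ℝ) (a : ℕ → ℕ → ℝ → ℝ)
    {q d : ℕ} (hm0 : m 0 = 0) (s : Fin d → ℕ)
    (hsq : ∑ k, s k ≤ q) (f : Fin d → ℝ → ℝ) (x : Fin d → ℝ)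
    (hf : ∀ k i, s k ≤ i → Uop m pts a i (f k) (x k) = f k (x k)) :
    Smolyak m pts a q d (fun y => ∏ k, f k (y k)) x = ∏ k, f k (x k) := by
  have telescope (k : Fin d) : f k (x k) = ∑ i ∈ Finset.Icc 1 (s k),
      (Uop m pts a i (f k) (x k) - Uop m pts a (i - 1) (f k) (x k)) := by
    rw [← Finset.Ico_add_one_right_eq_Icc, Finset.sum_Ico_eq_sum_range]
    simp only [Nat.add_sub_cancel, Nat.add_comm 1]
    rw [Finset.sum_range_sub (fun i => Uop m pts a i (f k) (x k)), Uop_zero_index m pts a hm0,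
      hf k _ le_rfl, sub_zero]
  simp only [telescope, Finset.prod_univ_sum]
  simp only [Smolyak, Dtensor_prod]
  symm
  apply Finset.sum_subset
  · intro ι hι
    simp only [Fintype.mem_piFinset, Finset.mem_Icc, Finset.mem_filter] at hι ⊢
    refine ⟨fun k => ⟨(hι k).1, (hι k).2.trans ?_⟩,
      (Finset.sum_le_sum fun k _ => (hι k).2).trans hsq⟩
    exact (Finset.single_le_sum (fun _ _ => Nat.zero_le _) (Finset.mem_univ k)).trans hsq
  · intro ι hι hι'
    simp only [Fintype.mem_piFinset, Finset.mem_Icc, Finset.mem_filter] at hι hι'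
    push Not at hι'
    obtain ⟨k, hk⟩ := hι'
    have hlt := hk (hι.1 k).1
    refine Finset.prod_eq_zero (Finset.mem_univ k) ?_
    rw [hf k _ hlt.le, hf k _ (Nat.le_sub_one_of_lt hlt), sub_self]

/-- if each `U^i` reproduces polynomials of degree at most `m_i − 1`,
then `Sm(q,d)` is exact on the polynomial space `E(q,d)`: it reproduces every
monomial `x ↦ x₁^{α₁}⋯x_d^{α_d}` for which there is `𝐢 ≥ 1` with `‖𝐢‖₁ = q` and
`α_k ≤ m_{i_k} − 1` for all `k`, and consequently every `g` in the span of these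
monomials. -/
theorem smolyak_exact_on_Eqd
    (m : ℕ → ℕ) (pts : ℕ → ℕ → ℝ) (a : ℕ → ℕ → ℝ → ℝ)
    (hm0 : m 0 = 0) (hmpos : ∀ i, 1 ≤ i → 1 ≤ m i) (hmono : Monotone m)
    (hpts : ∀ i, 1 ≤ i → ∀ j < m i, pts i j ∈ Set.Icc (0 : ℝ) 1)
    (hdist : ∀ i, 1 ≤ i → ∀ j < m i, ∀ k < m i, pts i j = pts i k → j = k)
    (hacont : ∀ i j, Continuous (a i j))
    (hdelta : ∀ i, 1 ≤ i → ∀ j < m i, ∀ k < m i,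
      a i j (pts i k) = if j = k then 1 else 0)
    (hexact : ∀ i, 1 ≤ i → ∀ p : Polynomial ℝ, p.natDegree ≤ m i - 1 →
      ∀ t ∈ Set.Icc (0 : ℝ) 1, Uop m pts a i (fun u => p.eval u) t = p.eval t)
    (d q : ℕ) (hd : 1 ≤ d) (hq : d ≤ q) :
    (∀ α : Fin d → ℕ,
      (∃ ι : Fin d → ℕ, (∀ k, 1 ≤ ι k) ∧ (∑ k, ι k = q) ∧ ∀ k, α k ≤ m (ι k) - 1) →
      ∀ x ∈ Set.Icc (0 : Fin d → ℝ) 1,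
        Smolyak m pts a q d (fun y => ∏ k, y k ^ α k) x = ∏ k, x k ^ α k)
    ∧ (∀ g ∈ Submodule.span ℝ {h : (Fin d → ℝ) → ℝ |
          ∃ α : Fin d → ℕ,
            (∃ ι : Fin d → ℕ, (∀ k, 1 ≤ ι k) ∧ (∑ k, ι k = q) ∧
              ∀ k, α k ≤ m (ι k) - 1) ∧
            h = fun y => ∏ k, y k ^ α k},
        ∀ x ∈ Set.Icc (0 : Fin d → ℝ) 1, Smolyak m pts a q d g x = g x) := by
  have monomial_exact : ∀ α : Fin d → ℕ,
      (∃ ι : Fin d → ℕ, (∀ k, 1 ≤ ι k) ∧ (∑ k, ι k = q) ∧ ∀ k, α k ≤ m (ι k) - 1) →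
      ∀ x ∈ Set.Icc (0 : Fin d → ℝ) 1,
        Smolyak m pts a q d (fun y => ∏ k, y k ^ α k) x = ∏ k, x k ^ α k := by
    rintro α ⟨s, hs, hsq, hα⟩ x hx
    refine Smolyak_prod_eq m pts a hm0 s hsq.le (fun k t => t ^ α k) x fun k i hi => ?_
    have hdeg : (Polynomial.X ^ α k : Polynomial ℝ).natDegree ≤ m i - 1 := by
      rw [Polynomial.natDegree_X_pow]
      exact (hα k).trans (Nat.sub_le_sub_right (hmono hi) 1)
    simpa using hexact i ((hs k).trans hi) _ hdeg (x k) ⟨hx.1 k, hx.2 k⟩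
  refine ⟨monomial_exact, fun g hg x hx => ?_⟩
  induction hg using Submodule.span_induction with
  | mem g hg =>
    obtain ⟨α, hα, rfl⟩ := hg
    exact monomial_exact α hα x hx
  | zero => exact Smolyak_zero m pts a q d x
  | add f g _ _ hf hg => rw [Smolyak_add, hf, hg, Pi.add_apply]
  | smul c f _ hf => rw [Smolyak_smul, hf, Pi.smul_apply, smul_eq_mul]
end
end

section
/- There exists a constant C > 0 such that for every m ≥ 3 the Lebesgue constant of polynomial interpolation at the m Chebyshev extrema points satisfies Λ_m := sup{‖U_m(f)‖_∞ : f ∈ C[0,1], ‖f‖_∞ = 1} < (2/π)·ln(m−1) + C, where U_m(f) is the unique polynomial of degree < m interpolating f at the points x_j = 1/2 − (1/2)·cos((j−1)π/(m−1)), j = 1,…,m. -/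
noncomputable section

/-- The `m` Chebyshev extrema points in `[0,1]`:
`x_j = 1/2 − (1/2)·cos((j−1)π/(m−1))`, `j = 1,…,m`. -/
def chebNode (m j : ℕ) : ℝ :=
  1 / 2 - (1 / 2) * Real.cos (((j : ℝ) - 1) * Real.pi / ((m : ℝ) - 1))

open Finset in
/-- The modified Dirichlet kernel `1 + 2 ∑_{0 < j < n} cos (j t) + cos (n t)`, with its terms
grouped in consecutive pairs. -/
def modDirichletKernel (n : ℕ) (t : ℝ) : ℝ :=
  ∑ j ∈ range n, (Real.cos (j * t) + Real.cos ((j + 1 : ℕ) * t))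

lemma modDirichletKernel_mul_sin (n : ℕ) (t : ℝ) :
    modDirichletKernel n t * Real.sin (t / 2) = Real.sin (n * t) * Real.cos (t / 2) := by
  induction n with
  | zero => simp [modDirichletKernel]
  | succ n ih =>
    rw [modDirichletKernel, Finset.sum_range_succ, ← modDirichletKernel, add_mul, ih]
    obtain ⟨u, rfl⟩ : ∃ u, t = 2 * u := ⟨t / 2, by ring⟩
    have h : ((n + 1 : ℕ) : ℝ) * (2 * u) = n * (2 * u) + 2 * u := by push_cast; ring
    have hu : 2 * u / 2 = u := by ring
    rw [h, hu, Real.cos_add, Real.sin_add, Real.cos_two_mul, Real.sin_two_mul]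
    linear_combination (-2 * Real.sin (n * (2 * u)) * Real.cos u) * Real.sin_sq u

lemma modDirichletKernel_neg (n : ℕ) (t : ℝ) :
    modDirichletKernel n (-t) = modDirichletKernel n t := by
  simp only [modDirichletKernel, mul_neg, Real.cos_neg]

lemma modDirichletKernel_periodic (n : ℕ) :
    Function.Periodic (modDirichletKernel n) (2 * Real.pi) := fun t => by
  simp only [modDirichletKernel, mul_add, Real.cos_add_nat_mul_two_pi]

lemma modDirichletKernel_zero (n : ℕ) : modDirichletKernel n 0 = 2 * n := by
  simp [modDirichletKernel]; ring

lemma abs_modDirichletKernel_le (n : ℕ) (t : ℝ) : |modDirichletKernel n t| ≤ 2 * n := by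
  calc |modDirichletKernel n t| ≤ ∑ _j ∈ Finset.range n, (2 : ℝ) := by
        refine (Finset.abs_sum_le_sum_abs _ _).trans (Finset.sum_le_sum fun j _ => ?_)
        refine (abs_add_le _ _).trans ?_
        linarith [Real.abs_cos_le_one (j * t), Real.abs_cos_le_one ((j + 1 : ℕ) * t)]
    _ = 2 * n := by simp [mul_comm]

lemma mul_cos_le_sin {u : ℝ} (h0 : 0 ≤ u) (h1 : u ≤ Real.pi / 2) :
    u * Real.cos u ≤ Real.sin u := by
  rcases h1.lt_or_eq with h | rfl
  · have hc : 0 < Real.cos u := Real.cos_pos_of_mem_Ioo ⟨by linarith [Real.pi_pos], h⟩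
    have := Real.le_tan h0 h
    rwa [Real.tan_eq_sin_div_cos, le_div_iff₀ hc] at this
  · simp

lemma abs_modDirichletKernel_le_two_div (n : ℕ) {t : ℝ} (h0 : 0 < t) (h1 : t ≤ Real.pi) :
    |modDirichletKernel n t| ≤ 2 / t := by
  have hs : 0 < Real.sin (t / 2) := Real.sin_pos_of_pos_of_lt_pi (by linarith) (by linarith)
  have hc : 0 ≤ Real.cos (t / 2) := Real.cos_nonneg_of_mem_Icc ⟨by linarith, by linarith⟩
  have hm := mul_cos_le_sin (u := t / 2) (by linarith) (by linarith)
  have hk : |modDirichletKernel n t| * Real.sin (t / 2) ≤ Real.cos (t / 2) := by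
    have h := congrArg abs (modDirichletKernel_mul_sin n t)
    rw [abs_mul, abs_mul, abs_of_pos hs, abs_of_nonneg hc] at h
    rw [h]
    exact mul_le_of_le_one_left hc (Real.abs_sin_le_one _)
  rw [le_div_iff₀ h0]
  refine le_of_mul_le_mul_right ?_ hs
  nlinarith

lemma modDirichletKernel_int_mul (n : ℕ) (hn : 0 < n) (l : ℤ) (hl : ¬ (2 * n : ℤ) ∣ l) :
    modDirichletKernel n (l * (Real.pi / n)) = 0 := by
  have hn' : (n : ℝ) ≠ 0 := by positivity
  have h := modDirichletKernel_mul_sin n (l * (Real.pi / n))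
  rw [show (n : ℝ) * (l * (Real.pi / n)) = l * Real.pi by field_simp, Real.sin_int_mul_pi,
    zero_mul] at h
  refine (mul_eq_zero.mp h).resolve_right fun hs => hl ?_
  obtain ⟨k, hk⟩ := Real.sin_eq_zero_iff.mp hs
  refine ⟨k, ?_⟩
  field_simp at hk
  have : (l : ℝ) = 2 * n * k := by linarith
  exact_mod_cast this

/-- Sum of `|modDirichletKernel n|` over `2 n` equispaced points of a period, starting at `θ`. -/
def kernelAbsSum (n : ℕ) (θ : ℝ) : ℝ :=
  ∑ k ∈ Finset.range (2 * n), |modDirichletKernel n (θ + k * (Real.pi / n))|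

lemma kernelAbsSum_periodic (n : ℕ) (hn : 0 < n) :
    Function.Periodic (kernelAbsSum n) (Real.pi / n) := fun θ => by
  have hn' : (n : ℝ) ≠ 0 := by positivity
  have h := Finset.sum_range_succ'
    (fun k : ℕ => |modDirichletKernel n (θ + k * (Real.pi / n))|) (2 * n)
  rw [Finset.sum_range_succ] at h
  have hp : modDirichletKernel n (θ + (2 * n : ℕ) * (Real.pi / n)) =
      modDirichletKernel n (θ + (0 : ℕ) * (Real.pi / n)) := by
    rw [← modDirichletKernel_periodic n (θ + (0 : ℕ) * (Real.pi / n))]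
    congr 1
    push_cast
    field_simp
    ring
  rw [hp] at h
  rw [kernelAbsSum, kernelAbsSum, add_right_cancel h]
  refine Finset.sum_congr rfl fun k _ => ?_
  congr 2
  push_cast
  ring

lemma sum_abs_modDirichletKernel_half_le (n : ℕ) (hn : 0 < n) {δ : ℝ} (h0 : 0 ≤ δ)
    (h1 : δ ≤ Real.pi / n) :
    ∑ k ∈ Finset.range n, |modDirichletKernel n (δ + k * (Real.pi / n))| ≤
      2 * n * (1 + (1 + Real.log n) / Real.pi) := by
  have hn' : (0 : ℝ) < n := by positivity
  have hpi := Real.pi_pos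
  obtain ⟨p, rfl⟩ : ∃ p, n = p + 1 := ⟨n - 1, by omega⟩
  set n := p + 1 with hp
  have hh : ((harmonic p : ℚ) : ℝ) ≤ 1 + Real.log n := by
    refine (harmonic_le_one_add_log p).trans ?_
    rcases Nat.eq_zero_or_pos p with rfl | hpos
    · simp [hp]
    · gcongr
      omega
  rw [Finset.sum_range_succ']
  have hterm : ∀ k ∈ Finset.range p,
      |modDirichletKernel n (δ + (k + 1 : ℕ) * (Real.pi / n))| ≤
        2 * n / Real.pi * ((k + 1 : ℕ) : ℝ)⁻¹ := fun k hk => by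
    have hk' : ((k + 1 : ℕ) : ℝ) + 1 ≤ n := by
      have := Finset.mem_range.mp hk
      exact_mod_cast (by omega : k + 1 + 1 ≤ n)
    have hq : 0 < Real.pi / n := by positivity
    have hkq : 0 < ((k + 1 : ℕ) : ℝ) * (Real.pi / n) := by positivity
    have hle : δ + (k + 1 : ℕ) * (Real.pi / n) ≤ Real.pi := by
      have := mul_le_mul_of_nonneg_right hk' hq.le
      rw [mul_div_cancel₀ _ hn'.ne'] at this
      linarith
    refine (abs_modDirichletKernel_le_two_div n (by linarith) hle).trans ?_
    calc 2 / (δ + (k + 1 : ℕ) * (Real.pi / n)) ≤ 2 / ((k + 1 : ℕ) * (Real.pi / n)) := by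
          gcongr; linarith
      _ = _ := by field_simp
  have hsum := Finset.sum_le_sum hterm
  rw [← Finset.mul_sum] at hsum
  have hH : ∑ k ∈ Finset.range p, ((k + 1 : ℕ) : ℝ)⁻¹ = ((harmonic p : ℚ) : ℝ) := by
    simp [harmonic]
  rw [hH] at hsum
  have h2 := mul_le_mul_of_nonneg_left hh (by positivity : 0 ≤ 2 * (n : ℝ) / Real.pi)
  have h3 := abs_modDirichletKernel_le n (δ + (0 : ℕ) * (Real.pi / n))
  calc _ ≤ 2 * (n : ℝ) / Real.pi * (1 + Real.log n) + 2 * n := by linarith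
    _ = _ := by ring

lemma kernelAbsSum_le (n : ℕ) (hn : 0 < n) (θ : ℝ) :
    kernelAbsSum n θ ≤ 4 * n * (1 + (1 + Real.log n) / Real.pi) := by
  have hn' : (0 : ℝ) < n := by positivity
  obtain ⟨δ, ⟨h0, h1⟩, hδ⟩ := (kernelAbsSum_periodic n hn).exists_mem_Ico₀
    (div_pos Real.pi_pos hn') θ
  rw [hδ, kernelAbsSum, two_mul, Finset.sum_range_add]
  have hA := sum_abs_modDirichletKernel_half_le n hn h0 h1.le
  have hB := sum_abs_modDirichletKernel_half_le n hn (δ := Real.pi / n - δ)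
    (by linarith) (by linarith)
  have hC : ∑ k ∈ Finset.range n, |modDirichletKernel n (δ + (n + k : ℕ) * (Real.pi / n))| =
      ∑ k ∈ Finset.range n,
        |modDirichletKernel n (Real.pi / n - δ + k * (Real.pi / n))| := by
    rw [← Finset.sum_range_reflect]
    refine Finset.sum_congr rfl fun k hk => ?_
    have hk' := Finset.mem_range.mp hk
    congr 1
    rw [← modDirichletKernel_neg n (Real.pi / n - δ + _), ← modDirichletKernel_periodic n (-_)]
    congr 1
    have : ((n + (n - 1 - k) : ℕ) : ℝ) = 2 * n - 1 - k := by
      rw [Nat.cast_add, Nat.sub_sub, Nat.cast_sub (by omega)]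
      push_cast
      ring
    rw [this]
    field_simp
    ring
  rw [hC]
  linarith

open Polynomial in
/-- The polynomial whose value at `cos θ` is the symmetrised modified Dirichlet kernel at `θ`
and `φ`, where `c = cos φ`. -/
def kernelPoly (n : ℕ) (c : ℝ) : ℝ[X] :=
  ∑ j ∈ Finset.range n, (C ((Chebyshev.T ℝ (j : ℕ)).eval c) * Chebyshev.T ℝ (j : ℕ) +
    C ((Chebyshev.T ℝ (j + 1 : ℕ)).eval c) * Chebyshev.T ℝ (j + 1 : ℕ))

lemma kernelPoly_eval_cos (n : ℕ) (φ θ : ℝ) :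
    (kernelPoly n (Real.cos φ)).eval (Real.cos θ) =
      (modDirichletKernel n (θ - φ) + modDirichletKernel n (θ + φ)) / 2 := by
  simp only [kernelPoly, modDirichletKernel, Polynomial.eval_finsetSum, Polynomial.eval_add,
    Polynomial.eval_mul, Polynomial.eval_C, Polynomial.Chebyshev.T_real_cos, Int.cast_natCast]
  rw [← Finset.sum_add_distrib, Finset.sum_div]
  refine Finset.sum_congr rfl fun j _ => ?_
  simp only [mul_sub, mul_add, Real.cos_sub, Real.cos_add]
  ring

lemma natDegree_kernelPoly_le (n : ℕ) (c : ℝ) : (kernelPoly n c).natDegree ≤ n := by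
  refine Polynomial.natDegree_sum_le_of_forall_le _ _ fun j hj => ?_
  have hj' := Finset.mem_range.mp hj
  refine Polynomial.natDegree_add_le_of_degree_le ?_ ?_ <;>
  · refine (Polynomial.natDegree_C_mul_le _ _).trans ?_
    rw [Polynomial.Chebyshev.natDegree_T, Int.natAbs_natCast]
    omega

/-- Interpolation formula on the Chebyshev extrema of `[-1, 1]`. -/
lemma eq_sum_kernelPoly (n : ℕ) (hn : 0 < n) (q : Polynomial ℝ) (hq : q.natDegree ≤ n) :
    q = ∑ k ∈ Finset.range (2 * n),
      Polynomial.C (q.eval (Real.cos (k * (Real.pi / n))) / (2 * n)) *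
        kernelPoly n (Real.cos (k * (Real.pi / n))) := by
  have hn' : (0 : ℝ) < n := by positivity
  have hpi := Real.pi_pos
  have hdeg : ∀ g : Polynomial ℝ, g.natDegree ≤ n → g.degree < (Finset.range (n + 1)).card := by
    intro g hg
    rw [Finset.card_range]
    exact lt_of_le_of_lt Polynomial.degree_le_natDegree (by exact_mod_cast Nat.lt_succ_of_le hg)
  have hinj : Set.InjOn (fun i : ℕ => Real.cos (i * (Real.pi / n)))
      (Finset.range (n + 1) : Finset ℕ) := by
    have hmem : ∀ i ∈ (Finset.range (n + 1) : Finset ℕ),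
        (i : ℝ) * (Real.pi / n) ∈ Set.Icc 0 Real.pi := by
      intro i hi
      refine ⟨by positivity, ?_⟩
      have : (i : ℝ) ≤ n := by exact_mod_cast Nat.le_of_lt_succ (Finset.mem_range.mp hi)
      calc (i : ℝ) * (Real.pi / n) ≤ n * (Real.pi / n) := by gcongr
        _ = Real.pi := by field_simp
    intro i hi j hj hij
    have := Real.injOn_cos (hmem i hi) (hmem j hj) hij
    exact_mod_cast mul_right_cancel₀ (by positivity) this
  refine Polynomial.eq_of_degrees_lt_of_eval_index_eq _ hinj (hdeg _ hq) (hdeg _ ?_) ?_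
  · exact Polynomial.natDegree_sum_le_of_forall_le _ _ fun k _ =>
      (Polynomial.natDegree_C_mul_le _ _).trans (natDegree_kernelPoly_le _ _)
  intro i hi
  have hi' : i ≤ n := Nat.le_of_lt_succ (Finset.mem_range.mp hi)
  simp only [Polynomial.eval_finsetSum, Polynomial.eval_mul, Polynomial.eval_C,
    kernelPoly_eval_cos]
  have hminus : ∀ k : ℕ, (i : ℝ) * (Real.pi / n) - k * (Real.pi / n) =
      ((i - k : ℤ) : ℝ) * (Real.pi / n) := fun k => by push_cast; ring
  have hplus : ∀ k : ℕ, (i : ℝ) * (Real.pi / n) + k * (Real.pi / n) =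
      ((i + k : ℤ) : ℝ) * (Real.pi / n) := fun k => by push_cast; ring
  have hA : ∑ k ∈ Finset.range (2 * n), q.eval (Real.cos (k * (Real.pi / n))) *
      modDirichletKernel n (i * (Real.pi / n) - k * (Real.pi / n)) =
      q.eval (Real.cos (i * (Real.pi / n))) * (2 * n) := by
    rw [Finset.sum_eq_single i]
    · rw [sub_self, modDirichletKernel_zero]
    · intro k hk hki
      have hk' := Finset.mem_range.mp hk
      rw [hminus, modDirichletKernel_int_mul n hn, mul_zero]
      intro hd
      have := Int.eq_zero_of_abs_lt_dvd hd (by rw [abs_lt]; constructor <;> omega)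
      omega
    · intro h
      exact absurd (Finset.mem_range.mpr (by omega)) h
  have hB : ∑ k ∈ Finset.range (2 * n), q.eval (Real.cos (k * (Real.pi / n))) *
      modDirichletKernel n (i * (Real.pi / n) + k * (Real.pi / n)) =
      q.eval (Real.cos (i * (Real.pi / n))) * (2 * n) := by
    rcases Nat.eq_zero_or_pos i with rfl | hpos
    · rw [← hA]
      refine Finset.sum_congr rfl fun k _ => ?_
      rw [← modDirichletKernel_neg]
      congr 2
      push_cast
      ring
    have hc : ((2 * n - i : ℕ) : ℝ) * (Real.pi / n) = 2 * Real.pi - i * (Real.pi / n) := by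
      rw [Nat.cast_sub (by omega)]
      push_cast
      field_simp
    rw [Finset.sum_eq_single (2 * n - i)]
    · rw [hc, Real.cos_two_pi_sub, add_sub_cancel, ← modDirichletKernel_zero,
        ← modDirichletKernel_periodic n 0, zero_add]
    · intro k hk hki
      have hk' := Finset.mem_range.mp hk
      rw [hplus, modDirichletKernel_int_mul n hn, mul_zero]
      intro hd
      have := Int.eq_zero_of_abs_lt_dvd (x := (i + k : ℤ) - 2 * n)
        (dvd_sub_self_right.mpr hd) (by rw [abs_lt]; constructor <;> omega)
      omega
    · intro h
      exact absurd (Finset.mem_range.mpr (by omega)) h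
  have hsplit : ∀ k : ℕ, q.eval (Real.cos (k * (Real.pi / n))) / (2 * n) *
      ((modDirichletKernel n (i * (Real.pi / n) - k * (Real.pi / n)) +
        modDirichletKernel n (i * (Real.pi / n) + k * (Real.pi / n))) / 2) =
      (q.eval (Real.cos (k * (Real.pi / n))) *
        modDirichletKernel n (i * (Real.pi / n) - k * (Real.pi / n)) +
      q.eval (Real.cos (k * (Real.pi / n))) *
        modDirichletKernel n (i * (Real.pi / n) + k * (Real.pi / n))) / (4 * n) :=
    fun k => by field_simp; ring
  simp only [hsplit]
  rw [← Finset.sum_div, Finset.sum_add_distrib, hA, hB]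
  field_simp
  ring

lemma abs_eval_cos_le (n : ℕ) (hn : 0 < n) (q : Polynomial ℝ) (hq : q.natDegree ≤ n)
    (hb : ∀ k : ℕ, k ≤ n → |q.eval (Real.cos (k * (Real.pi / n)))| ≤ 1) (θ : ℝ) :
    |q.eval (Real.cos θ)| ≤ 2 * (1 + (1 + Real.log n) / Real.pi) := by
  have hn' : (0 : ℝ) < n := by positivity
  have hb' : ∀ k ∈ Finset.range (2 * n), |q.eval (Real.cos (k * (Real.pi / n)))| ≤ 1 := by
    intro k hk
    have hk' := Finset.mem_range.mp hk
    rcases le_or_gt k n with h | h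
    · exact hb k h
    · have := hb (2 * n - k) (by omega)
      rwa [Nat.cast_sub hk'.le, sub_mul,
        show ((2 * n : ℕ) : ℝ) * (Real.pi / n) = 2 * Real.pi by push_cast; field_simp,
        Real.cos_two_pi_sub] at this
  rw [eq_sum_kernelPoly n hn q hq]
  simp only [Polynomial.eval_finsetSum, Polynomial.eval_mul, Polynomial.eval_C,
    kernelPoly_eval_cos]
  have hterm : ∀ k ∈ Finset.range (2 * n),
      |q.eval (Real.cos (k * (Real.pi / n))) / (2 * n) *
        ((modDirichletKernel n (θ - k * (Real.pi / n)) +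
          modDirichletKernel n (θ + k * (Real.pi / n))) / 2)| ≤
      (|modDirichletKernel n (-θ + k * (Real.pi / n))| +
        |modDirichletKernel n (θ + k * (Real.pi / n))|) / (4 * n) := fun k hk => by
    rw [← modDirichletKernel_neg n (-θ + _), neg_add, neg_neg, ← sub_eq_add_neg, abs_mul, abs_div,
      abs_div, abs_of_pos (by positivity : (0 : ℝ) < 2 * n), abs_two]
    calc _ ≤ 1 / (2 * (n : ℝ)) * ((|modDirichletKernel n (θ - k * (Real.pi / n))| +
          |modDirichletKernel n (θ + k * (Real.pi / n))|) / 2) := by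
          gcongr
          · exact hb' k hk
          · exact abs_add_le _ _
      _ = _ := by field_simp; ring
  refine (Finset.abs_sum_le_sum_abs _ _).trans ((Finset.sum_le_sum hterm).trans ?_)
  rw [← Finset.sum_div, Finset.sum_add_distrib, ← kernelAbsSum, ← kernelAbsSum,
    div_le_iff₀ (by positivity)]
  linarith [kernelAbsSum_le n hn θ, kernelAbsSum_le n hn (-θ)]

/-- A bound on the Chebyshev nodes in `[0, 1]` controls a polynomial of degree `≤ n` there. -/
lemma abs_eval_le_of_chebNode (n : ℕ) (hn : 0 < n) (p : Polynomial ℝ) (hp : p.natDegree ≤ n)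
    (hb : ∀ j ∈ Finset.Icc 1 (n + 1), |p.eval (chebNode (n + 1) j)| ≤ 1) {x : ℝ}
    (hx : x ∈ Set.Icc (0 : ℝ) 1) :
    |p.eval x| ≤ 2 * (1 + (1 + Real.log n) / Real.pi) := by
  set q : Polynomial ℝ := p.comp (Polynomial.C (1 / 2) - Polynomial.C (1 / 2) * Polynomial.X)
    with hqdef
  have hqe : ∀ y, q.eval y = p.eval (1 / 2 - 1 / 2 * y) := fun y => by
    simp [hqdef, Polynomial.eval_comp]
  have hlin : (Polynomial.C (1 / 2 : ℝ) - Polynomial.C (1 / 2) * Polynomial.X).natDegree ≤ 1 := by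
    compute_degree
  have hq : q.natDegree ≤ n := by
    refine Polynomial.natDegree_comp_le.trans ?_
    calc _ ≤ n * 1 := Nat.mul_le_mul hp hlin
      _ = n := mul_one n
  have hqb : ∀ k : ℕ, k ≤ n → |q.eval (Real.cos (k * (Real.pi / n)))| ≤ 1 := fun k hk => by
    have := hb (k + 1) (Finset.mem_Icc.mpr ⟨by omega, by omega⟩)
    rw [chebNode] at this
    rw [hqe]
    convert this using 6
    push_cast
    ring
  have := abs_eval_cos_le n hn q hq hqb (Real.arccos (1 - 2 * x))
  rw [Real.cos_arccos (by linarith [hx.2]) (by linarith [hx.1]), hqe] at this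
  convert this using 3
  ring

/-- there is a constant `C > 0` such that for every `m ≥ 3` the Lebesgue
constant of polynomial interpolation at the `m` Chebyshev extrema points satisfies
`Λ_m = sup{‖U_m(f)‖_∞ : ‖f‖_∞ = 1} < (2/π)·ln(m−1) + C`, where `U_m(f)` is the unique
polynomial of degree `< m` interpolating `f` at these points. -/
theorem lebesgue_constant_chebyshev_extrema :
    ∃ C : ℝ, 0 < C ∧ ∀ m : ℕ, 3 ≤ m →
      sSup {r : ℝ | ∃ (f : ℝ → ℝ) (p : Polynomial ℝ),
          ContinuousOn f (Set.Icc 0 1) ∧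
          sSup {v : ℝ | ∃ x ∈ Set.Icc (0 : ℝ) 1, v = |f x|} = 1 ∧
          p.natDegree < m ∧
          (∀ j ∈ Finset.Icc 1 m, p.eval (chebNode m j) = f (chebNode m j)) ∧
          r = sSup {v : ℝ | ∃ x ∈ Set.Icc (0 : ℝ) 1, v = |p.eval x|}} <
        2 / Real.pi * Real.log ((m : ℝ) - 1) + C := by
  have hpi := Real.pi_pos
  refine ⟨3 + 2 / Real.pi, by positivity, fun m hm => ?_⟩
  obtain ⟨n, rfl⟩ : ∃ n, m = n + 1 := ⟨m - 1, by omega⟩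
  have hn : 0 < n := by omega
  have hcast : ((n + 1 : ℕ) : ℝ) - 1 = n := by push_cast; ring
  have hlog : 0 ≤ Real.log n := Real.log_natCast_nonneg n
  have hB : 0 ≤ 2 * (1 + (1 + Real.log n) / Real.pi) := by positivity
  refine lt_of_le_of_lt (b := 2 * (1 + (1 + Real.log n) / Real.pi)) ?_ ?_
  · refine Real.sSup_le ?_ hB
    rintro r ⟨f, p, -, hf, hp, hint, rfl⟩
    refine Real.sSup_le ?_ hB
    rintro v ⟨x, hx, rfl⟩
    refine abs_eval_le_of_chebNode n hn p (Nat.le_of_lt_succ hp) (fun j hj => ?_) hx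
    have hbdd : BddAbove {v : ℝ | ∃ x ∈ Set.Icc (0 : ℝ) 1, v = |f x|} := by
      by_contra h
      rw [Real.sSup_of_not_bddAbove h] at hf
      exact zero_ne_one hf
    rw [hint j hj, ← hf]
    refine le_csSup hbdd ⟨_, ?_, rfl⟩
    rw [chebNode]
    constructor
    · linarith [Real.cos_le_one (((j : ℝ) - 1) * Real.pi / (((n + 1 : ℕ) : ℝ) - 1))]
    · linarith [Real.neg_one_le_cos (((j : ℝ) - 1) * Real.pi / (((n + 1 : ℕ) : ℝ) - 1))]
  · rw [hcast]
    have : 2 * (1 + (1 + Real.log n) / Real.pi) =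
        2 / Real.pi * Real.log n + (2 + 2 / Real.pi) := by ring
    linarith
end
end

section
/- Jackson's inequality on [0,1]: for every s ∈ ℕ, s ≥ 1, there is a constant c_s > 0 such that for every n ≥ 1 and every function f : [0,1] → ℝ whose derivatives f', f'', …, f^{(s)} exist and are continuous on [0,1], one has inf{‖f − p‖_∞ : p a polynomial of degree ≤ n} ≤ c_s · n^{−s} · max_{0 ≤ j ≤ s} ‖f^{(j)}‖_∞. -/
noncomputable section

open Polynomial in
theorem exists_derivative_eq (q : ℝ[X]) :
    ∃ p : ℝ[X], derivative p = q ∧ p.natDegree ≤ q.natDegree + 1 := by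
  refine ⟨∑ i ∈ Finset.range (q.natDegree + 1), C (q.coeff i / (i + 1)) * X ^ (i + 1), ?_, ?_⟩
  · rw [derivative_sum]
    conv_rhs => rw [q.as_sum_range_C_mul_X_pow]
    refine Finset.sum_congr rfl fun i _ => ?_
    have h : ((i : ℝ) + 1) ≠ 0 := by positivity
    rw [derivative_C_mul_X_pow]
    push_cast
    rw [div_mul_cancel₀ _ h]
  · refine natDegree_sum_le_of_forall_le _ _ fun i hi => ?_
    have := Finset.mem_range.1 hi
    exact (natDegree_C_mul_X_pow_le _ _).trans (by omega)

open Polynomial in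
/-- The Dirichlet kernel, as a polynomial in the sine. -/
theorem exists_dirichlet_polynomial (k : ℕ) :
    ∃ R : ℝ[X], R.natDegree ≤ 2 * k ∧ ∀ θ : ℝ, R.eval (Real.sin θ) =
      1 + 2 * ∑ j ∈ Finset.range k, Real.cos (2 * (j + 1) * θ) := by
  refine ⟨1 + C 2 * ∑ j ∈ Finset.range k,
    (Chebyshev.T ℝ ((j + 1 : ℕ) : ℤ)).comp (1 - C 2 * X ^ 2), ?_, fun θ => ?_⟩
  · refine (natDegree_add_le _ _).trans (max_le (by simp) ?_)
    refine (natDegree_C_mul_le _ _).trans (natDegree_sum_le_of_forall_le _ _ fun j hj => ?_)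
    have hj := Finset.mem_range.1 hj
    refine natDegree_comp_le.trans ?_
    rw [Chebyshev.natDegree_T, Int.natAbs_natCast]
    have h2 : (1 - C (2 : ℝ) * X ^ 2 : ℝ[X]).natDegree ≤ 2 :=
      (natDegree_sub_le _ _).trans (max_le (by simp) (natDegree_C_mul_X_pow_le _ _))
    nlinarith
  · have hc : 1 - 2 * Real.sin θ ^ 2 = Real.cos (2 * θ) := by
      rw [Real.cos_two_mul, Real.cos_sq']; ring
    simp only [eval_add, eval_one, eval_mul, eval_C, eval_finsetSum, eval_comp, eval_sub,
      eval_pow, eval_X, hc, Chebyshev.T_real_cos]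
    congr 2
    refine Finset.sum_congr rfl fun j _ => ?_
    push_cast
    ring_nf

theorem dirichlet_kernel_mul_sin (k : ℕ) (θ : ℝ) :
    (1 + 2 * ∑ j ∈ Finset.range k, Real.cos (2 * (j + 1) * θ)) * Real.sin θ =
      Real.sin ((2 * k + 1) * θ) := by
  induction k with
  | zero => simp
  | succ k ih =>
    have h := Real.sin_sub_sin ((2 * (k + 1) + 1) * θ) ((2 * k + 1) * θ)
    have e1 : ((2 * (k + 1) + 1) * θ - (2 * k + 1) * θ) / 2 = θ := by ring
    have e2 : ((2 * (k + 1) + 1) * θ + (2 * k + 1) * θ) / 2 = 2 * (k + 1) * θ := by ring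
    rw [e1, e2] at h
    rw [Finset.sum_range_succ]
    push_cast
    linear_combination ih - h

open Polynomial in
theorem exists_localized_polynomial (k : ℕ) :
    ∃ R : ℝ[X], R.natDegree ≤ 2 * k ∧
      (∀ v : ℝ, |v| ≤ 1 → |R.eval v| ≤ 2 * (2 * k + 1) / (1 + (2 * k + 1) * |v|)) ∧
      ∀ v : ℝ, 0 ≤ v → 2 * (2 * k + 1) * v ≤ 1 → (2 * k + 1) / 2 ≤ R.eval v := by
  obtain ⟨R, hdeg, hR⟩ := exists_dirichlet_polynomial k
  refine ⟨R, hdeg, fun v hv => ?_, fun v hv0 hv => ?_⟩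
  · obtain ⟨hv1, hv2⟩ := abs_le.1 hv
    have hs := Real.sin_arcsin hv1 hv2
    have hE := hR (Real.arcsin v)
    have hM := dirichlet_kernel_mul_sin k (Real.arcsin v)
    rw [← hE, hs] at hM
    rw [hs] at hE
    have h1 : |R.eval v| * |v| ≤ 1 := by
      rw [← abs_mul, hM]; exact Real.abs_sin_le_one _
    have h2 : |R.eval v| ≤ 2 * k + 1 := by
      have : |∑ j ∈ Finset.range k, Real.cos (2 * (j + 1) * Real.arcsin v)| ≤ k := by
        refine (Finset.abs_sum_le_sum_abs _ _).trans ?_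
        refine (Finset.sum_le_card_nsmul _ _ 1 fun j _ => Real.abs_cos_le_one _).trans ?_
        simp
      rw [hE]
      obtain ⟨_, _⟩ := abs_le.1 this
      exact abs_le.2 ⟨by linarith, by linarith⟩
    have hk : (0 : ℝ) ≤ 2 * k + 1 := by positivity
    rw [le_div_iff₀ (by positivity)]
    nlinarith [mul_le_mul_of_nonneg_left h1 hk]
  · have hm : (1 : ℝ) ≤ 2 * k + 1 := by linarith [Nat.cast_nonneg (α := ℝ) k]
    have hv1 : v ≤ 1 := by nlinarith
    have hs := Real.sin_arcsin (by linarith) hv1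
    have ha0 : 0 ≤ Real.arcsin v := Real.arcsin_nonneg.2 hv0
    have hJ := Real.mul_le_sin ha0 (Real.arcsin_le_pi_div_two v)
    have ha : Real.arcsin v ≤ 2 * v := by
      rw [hs, div_mul_eq_mul_div, div_le_iff₀ Real.pi_pos] at hJ
      nlinarith [Real.pi_lt_four]
    have hE := hR (Real.arcsin v)
    rw [hs] at hE
    rw [hE]
    have : (k : ℝ) * (1 / 2) ≤ ∑ j ∈ Finset.range k, Real.cos (2 * (j + 1) * Real.arcsin v) := by
      have := Finset.card_nsmul_le_sum (Finset.range k)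
        (fun j : ℕ => Real.cos (2 * (j + 1) * Real.arcsin v)) (1 / 2) fun j hj => ?_
      · simpa using this
      · have hjk : (j : ℝ) + 1 ≤ k := by exact_mod_cast Finset.mem_range.1 hj
        have hy0 : 0 ≤ 2 * ((j : ℝ) + 1) * Real.arcsin v := by positivity
        have hy1 : 2 * ((j : ℝ) + 1) * Real.arcsin v ≤ 1 := by
          calc 2 * ((j : ℝ) + 1) * Real.arcsin v ≤ 2 * k * (2 * v) := by gcongr
            _ ≤ 1 := by nlinarith
        have := Real.one_sub_sq_div_two_le_cos (x := 2 * ((j : ℝ) + 1) * Real.arcsin v)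
        nlinarith
    linarith

open Polynomial in
theorem eval_one_sub_eval_le_of_derivative_le {m : ℝ} (hm : 0 < m) (p : ℝ[X])
    (hp : ∀ u, 0 ≤ u → u ≤ 1 → (derivative p).eval u ≤ (2 * m / (1 + m * u)) ^ 4)
    {x : ℝ} (hx0 : 0 ≤ x) (hx1 : x ≤ 1) :
    p.eval 1 - p.eval x ≤ 8 * m ^ 3 / (1 + m * x) ^ 2 := by
  have hpos : ∀ u : ℝ, 0 ≤ u → 0 < 1 + m * u := fun u hu => by positivity
  have hd : ∀ u : ℝ, 0 ≤ u → HasDerivAt (fun u => p.eval u + 8 * m ^ 3 / (1 + m * u) ^ 2)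
      ((derivative p).eval u - 16 * m ^ 4 / (1 + m * u) ^ 3) u := fun u hu => by
    have h0 := (hpos u hu).ne'
    have h1 : HasDerivAt (fun u => 1 + m * u) m u := by
      simpa using ((hasDerivAt_id u).const_mul m).const_add 1
    refine ((p.hasDerivAt u).add ((hasDerivAt_const u (8 * m ^ 3)).div (h1.fun_pow 2)
      (pow_ne_zero 2 h0))).congr_deriv ?_
    field_simp
    ring
  have hanti : AntitoneOn (fun u => p.eval u + 8 * m ^ 3 / (1 + m * u) ^ 2) (Set.Icc 0 1) := by
    refine antitoneOn_of_deriv_nonpos (convex_Icc 0 1)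
      (fun u hu => (hd u hu.1).continuousAt.continuousWithinAt)
      (fun u hu => (hd u ?_).differentiableAt.differentiableWithinAt) fun u hu => ?_
    · exact (interior_subset hu).1
    · have hu := interior_subset hu
      rw [(hd u hu.1).deriv, sub_nonpos]
      refine (hp u hu.1 hu.2).trans ?_
      have h0 := hpos u hu.1
      have h1 : 1 ≤ 1 + m * u := by nlinarith [mul_nonneg hm.le hu.1]
      rw [div_pow, div_le_div_iff₀ (by positivity) (by positivity)]
      have : (1 + m * u) ^ 3 ≤ (1 + m * u) ^ 4 := pow_le_pow_right₀ h1 (by norm_num)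
      have h4 : 0 ≤ 16 * m ^ 4 := by positivity
      calc (2 * m) ^ 4 * (1 + m * u) ^ 3 = 16 * m ^ 4 * (1 + m * u) ^ 3 := by ring
        _ ≤ _ := mul_le_mul_of_nonneg_left this h4
  have h := hanti ⟨hx0, hx1⟩ ⟨zero_le_one, le_rfl⟩ hx1
  have h8 : 0 ≤ 8 * m ^ 3 / (1 + m * 1) ^ 2 := by positivity
  simp only at h
  linarith

open Polynomial in
/-- A polynomial close on `[-1, 1]` to the indicator function of the nonnegative reals. -/
theorem exists_polynomial_near_heaviside (k : ℕ) :
    ∃ P : ℝ[X], P.natDegree ≤ 8 * k + 1 ∧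
      (∀ x : ℝ, 0 ≤ x → x ≤ 1 → |1 - P.eval x| ≤ 256 / (1 + (2 * k + 1) * x) ^ 2) ∧
      ∀ x : ℝ, 0 ≤ x → x ≤ 1 → |P.eval (-x)| ≤ 256 / (1 + (2 * k + 1) * x) ^ 2 := by
  obtain ⟨R, hdeg, hup, hlow⟩ := exists_localized_polynomial k
  obtain ⟨S, hS, hSdeg⟩ := exists_derivative_eq (R ^ 4)
  set m : ℝ := 2 * k + 1 with hm
  have hm1 : 1 ≤ m := by linarith [Nat.cast_nonneg (α := ℝ) k]
  have hm0 : 0 < m := by linarith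
  have hR4 : ∀ v : ℝ, |v| ≤ 1 → (R ^ 4).eval v ≤ (2 * m / (1 + m * |v|)) ^ 4 := fun v hv => by
    rw [eval_pow, ← (by decide : Even 4).pow_abs (R.eval v)]
    exact pow_le_pow_left₀ (abs_nonneg _) (hup v hv) 4
  have hmono : Monotone fun u => S.eval u := by
    refine monotone_of_deriv_nonneg S.differentiable fun u => ?_
    rw [Polynomial.deriv, hS, eval_pow]
    exact (by decide : Even 4).pow_nonneg _
  have hI : m ^ 3 / 32 ≤ S.eval 1 - S.eval (-1) := by
    have h := Convex.mul_sub_le_image_sub_of_le_deriv (convex_Icc 0 (1 / (2 * m)))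
      (f := fun u => S.eval u) S.continuous.continuousOn S.differentiable.differentiableOn
      (C := (m / 2) ^ 4) (fun u hu => ?_) 0 ⟨le_rfl, by positivity⟩ (1 / (2 * m))
      ⟨by positivity, le_rfl⟩ (by positivity)
    · have h1 : S.eval (1 / (2 * m)) ≤ S.eval 1 :=
        hmono (by rw [div_le_one (by positivity)]; linarith)
      have h2 : S.eval (-1) ≤ S.eval 0 := hmono (by norm_num)
      have e : (m / 2) ^ 4 * (1 / (2 * m) - 0) = m ^ 3 / 32 := by field_simp; norm_num
      simp only [e] at h
      linarith
    · have hu := interior_subset hu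
      rw [Polynomial.deriv, hS, eval_pow]
      refine pow_le_pow_left₀ (by positivity) (hlow u hu.1 ?_) 4
      have := hu.2
      rw [le_div_iff₀ (by positivity)] at this
      linarith
  have hright : ∀ x : ℝ, 0 ≤ x → x ≤ 1 → S.eval 1 - S.eval x ≤ 8 * m ^ 3 / (1 + m * x) ^ 2 := by
    intro x hx0 hx1
    refine eval_one_sub_eval_le_of_derivative_le hm0 S (fun u hu0 hu1 => ?_) hx0 hx1
    have := hR4 u (by rwa [abs_of_nonneg hu0])
    rwa [abs_of_nonneg hu0, ← hS] at this
  have hleft : ∀ x : ℝ, 0 ≤ x → x ≤ 1 →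
      S.eval (-x) - S.eval (-1) ≤ 8 * m ^ 3 / (1 + m * x) ^ 2 := by
    intro x hx0 hx1
    have h := eval_one_sub_eval_le_of_derivative_le hm0 (-(S.comp (-X))) (fun u hu0 hu1 => ?_)
      hx0 hx1
    · simp only [eval_neg, eval_comp, eval_X] at h
      linarith
    · have := hR4 (-u) (by rwa [abs_neg, abs_of_nonneg hu0])
      rw [abs_neg, abs_of_nonneg hu0] at this
      simpa [derivative_comp, hS] using this
  set I := S.eval 1 - S.eval (-1) with hIdef
  have hI0 : 0 < I := lt_of_lt_of_le (by positivity) hI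
  have key : ∀ x : ℝ, 0 ≤ x → ∀ a : ℝ, 0 ≤ a → a ≤ 8 * m ^ 3 / (1 + m * x) ^ 2 →
      |I⁻¹ * a| ≤ 256 / (1 + m * x) ^ 2 := fun x hx a ha0 ha => by
    have h0 : 0 < 1 + m * x := by positivity
    rw [abs_of_nonneg (by positivity), inv_mul_eq_div, div_le_iff₀ hI0]
    calc a ≤ 8 * m ^ 3 / (1 + m * x) ^ 2 := ha
      _ = 256 / (1 + m * x) ^ 2 * (m ^ 3 / 32) := by ring
      _ ≤ _ := by gcongr
  refine ⟨C I⁻¹ * (S - C (S.eval (-1))), ?_, fun x hx0 hx1 => ?_, fun x hx0 hx1 => ?_⟩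
  · refine (natDegree_C_mul_le _ _).trans ((natDegree_sub_C).le.trans (hSdeg.trans ?_))
    have := natDegree_pow_le (p := R) (n := 4)
    omega
  · have e : 1 - (C I⁻¹ * (S - C (S.eval (-1)))).eval x = I⁻¹ * (S.eval 1 - S.eval x) := by
      simp only [eval_mul, eval_C, eval_sub]
      field_simp
      rw [hIdef]; ring
    rw [e]
    exact key x hx0 _ (sub_nonneg.2 (hmono hx1)) (hright x hx0 hx1)
  · simp only [eval_mul, eval_C, eval_sub]
    exact key x hx0 _ (sub_nonneg.2 (hmono (by linarith))) (hleft x hx0 hx1)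

open Polynomial in
theorem exists_polynomial_eq_convolution (P : ℝ[X]) {g : ℝ → ℝ}
    (hg : ContinuousOn g (Set.Icc 0 1)) :
    ∃ p : ℝ[X], p.natDegree ≤ P.natDegree ∧
      ∀ x : ℝ, p.eval x = ∫ t in (0 : ℝ)..1, g t * P.eval (x - t) := by
  refine ⟨∑ i ∈ Finset.range (P.natDegree + 1),
    C (∫ t in (0 : ℝ)..1, g t * (hasseDeriv i P).eval (-t)) * X ^ i, ?_, fun x => ?_⟩
  · refine natDegree_sum_le_of_forall_le _ _ fun i hi => ?_
    have := Finset.mem_range.1 hi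
    exact (natDegree_C_mul_X_pow_le _ _).trans (by omega)
  · have e : ∀ t : ℝ, g t * P.eval (x - t) =
        ∑ i ∈ Finset.range (P.natDegree + 1), g t * (hasseDeriv i P).eval (-t) * x ^ i := by
      intro t
      rw [sub_eq_add_neg, ← taylor_eval, eval_eq_sum_range, natDegree_taylor, Finset.mul_sum]
      exact Finset.sum_congr rfl fun i _ => by rw [taylor_coeff, mul_assoc]
    simp only [e]
    rw [intervalIntegral.integral_finsetSum]
    · simp [eval_finsetSum]
    · intro i _
      refine ContinuousOn.intervalIntegrable_of_Icc zero_le_one ?_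
      refine (hg.mul ?_).mul continuousOn_const
      exact ((hasseDeriv i P).continuous.comp continuous_neg).continuousOn

theorem continuousOn_const_div_one_add_mul_sq {m : ℝ} (hm : 0 < m) (A : ℝ) (y : ℝ) :
    ContinuousOn (fun u => A / (1 + m * u) ^ 2) (Set.Icc 0 y) := by
  refine continuousOn_const.div (by fun_prop) fun u hu => ?_
  have := mul_nonneg hm.le hu.1
  positivity

theorem integral_const_div_one_add_mul_sq_le {m A y : ℝ} (hm : 0 < m) (hA : 0 ≤ A) (hy : 0 ≤ y) :
    ∫ u in (0 : ℝ)..y, A / (1 + m * u) ^ 2 ≤ A / m := by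
  have hpos : ∀ u : ℝ, 0 ≤ u → 0 < 1 + m * u := fun u hu => by positivity
  have hd : ∀ u : ℝ, 0 ≤ u →
      HasDerivAt (fun u => -(A / m) / (1 + m * u)) (A / (1 + m * u) ^ 2) u := fun u hu => by
    have h0 := (hpos u hu).ne'
    have h1 : HasDerivAt (fun u => 1 + m * u) m u := by
      simpa using ((hasDerivAt_id u).const_mul m).const_add 1
    refine ((hasDerivAt_const u (-(A / m))).div h1 h0).congr_deriv ?_
    field_simp
    ring
  rw [intervalIntegral.integral_eq_sub_of_hasDerivAt_of_le hy
    (fun u hu => (hd u hu.1).continuousAt.continuousWithinAt) (fun u hu => hd u hu.1.le)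
    ((continuousOn_const_div_one_add_mul_sq hm A y).intervalIntegrable_of_Icc hy)]
  have : 0 ≤ A / m / (1 + m * y) := by have := hpos y hy; positivity
  simp only [mul_zero, add_zero, div_one, neg_div]
  linarith

open Polynomial in
theorem exists_polynomial_approx_of_derivWithin_le (k : ℕ) {f : ℝ → ℝ}
    (hf : ContDiffOn ℝ 1 f (Set.Icc 0 1)) {K : ℝ}
    (hK : ∀ x ∈ Set.Icc (0 : ℝ) 1, |derivWithin f (Set.Icc 0 1) x| ≤ K) :
    ∃ p : ℝ[X], p.natDegree ≤ 8 * k + 1 ∧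
      ∀ x ∈ Set.Icc (0 : ℝ) 1, |f x - p.eval x| ≤ 512 * K / (2 * k + 1) := by
  obtain ⟨P, hPdeg, hP1, hP2⟩ := exists_polynomial_near_heaviside k
  set g := derivWithin f (Set.Icc 0 1) with hgdef
  have hg : ContinuousOn g (Set.Icc 0 1) :=
    (hf.derivWithin (m := 0) (uniqueDiffOn_Icc zero_lt_one) (by norm_num)).continuousOn
  obtain ⟨q, hqdeg, hq⟩ := exists_polynomial_eq_convolution P hg
  have hm : (0 : ℝ) < 2 * k + 1 := by positivity
  have hK0 : 0 ≤ K := (abs_nonneg _).trans (hK 0 ⟨le_rfl, zero_le_one⟩)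
  set m : ℝ := 2 * k + 1
  refine ⟨C (f 0) + q, (natDegree_add_le _ _).trans
    (max_le (by simp) (hqdeg.trans hPdeg)), fun x ⟨hx0, hx1⟩ => ?_⟩
  have hsub1 : Set.Icc 0 x ⊆ Set.Icc (0 : ℝ) 1 := Set.Icc_subset_Icc_right hx1
  have hsub2 : Set.Icc x 1 ⊆ Set.Icc (0 : ℝ) 1 := Set.Icc_subset_Icc_left hx0
  have hPc : Continuous fun t => P.eval (x - t) :=
    P.continuous.comp (continuous_const.sub continuous_id)
  have hgP : ContinuousOn (fun t => g t * P.eval (x - t)) (Set.Icc 0 1) :=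
    hg.mul hPc.continuousOn
  have hftc : ∫ t in (0 : ℝ)..x, g t = f x - f 0 := by
    refine intervalIntegral.integral_eq_sub_of_hasDerivAt_of_le hx0 (hf.continuousOn.mono hsub1)
      (fun t ht => ?_) ((hg.mono hsub1).intervalIntegrable_of_Icc hx0)
    have ht' : t ∈ Set.Icc (0 : ℝ) 1 := ⟨ht.1.le, ht.2.le.trans hx1⟩
    exact ((hf.differentiableOn one_ne_zero) t ht').hasDerivWithinAt.hasDerivAt
      (Icc_mem_nhds ht.1 (ht.2.trans_le hx1))
  have hsplit : f x - (C (f 0) + q).eval x =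
      (∫ t in (0 : ℝ)..x, g t * (1 - P.eval (x - t))) - ∫ t in x..1, g t * P.eval (x - t) := by
    have i1 := (hgP.mono hsub1).intervalIntegrable_of_Icc (μ := MeasureTheory.volume) hx0
    have i2 := (hgP.mono hsub2).intervalIntegrable_of_Icc (μ := MeasureTheory.volume) hx1
    have i3 := (hg.mono hsub1).intervalIntegrable_of_Icc (μ := MeasureTheory.volume) hx0
    simp only [mul_sub, mul_one]
    rw [intervalIntegral.integral_sub i3 i1, hftc, eval_add, eval_C, hq,
      ← intervalIntegral.integral_add_adjacent_intervals i1 i2]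
    ring
  have b1 : |∫ t in (0 : ℝ)..x, g t * (1 - P.eval (x - t))| ≤ K * 256 / m := by
    have hintegrable : IntervalIntegrable (fun t => K * 256 / (1 + m * (x - t)) ^ 2)
        MeasureTheory.volume 0 x := by
      refine ContinuousOn.intervalIntegrable_of_Icc hx0 ?_
      exact (continuousOn_const_div_one_add_mul_sq hm (K * 256) x).comp
        (continuous_const.sub continuous_id).continuousOn
        fun t ht => ⟨sub_nonneg.2 ht.2, sub_le_self _ ht.1⟩
    rw [← Real.norm_eq_abs]
    refine (intervalIntegral.norm_integral_le_of_norm_le hx0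
      (.of_forall fun t ht => ?_) hintegrable).trans ?_
    · rw [Real.norm_eq_abs, abs_mul, mul_div_assoc]
      exact mul_le_mul (hK t (hsub1 ⟨ht.1.le, ht.2⟩))
        (hP1 _ (sub_nonneg.2 ht.2) (by linarith [ht.1])) (abs_nonneg _) hK0
    · rw [intervalIntegral.integral_comp_sub_left (fun u => K * 256 / (1 + m * u) ^ 2)]
      simpa using integral_const_div_one_add_mul_sq_le hm (A := K * 256) (by positivity) hx0
  have b2 : |∫ t in x..1, g t * P.eval (x - t)| ≤ K * 256 / m := by
    have hintegrable : IntervalIntegrable (fun t => K * 256 / (1 + m * (t - x)) ^ 2)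
        MeasureTheory.volume x 1 := by
      refine ContinuousOn.intervalIntegrable_of_Icc hx1 ?_
      exact (continuousOn_const_div_one_add_mul_sq hm (K * 256) (1 - x)).comp
        (continuous_id.sub continuous_const).continuousOn
        fun t ht => ⟨sub_nonneg.2 ht.1, sub_le_sub_right ht.2 _⟩
    rw [← Real.norm_eq_abs]
    refine (intervalIntegral.norm_integral_le_of_norm_le hx1
      (.of_forall fun t ht => ?_) hintegrable).trans ?_
    · have := hP2 (t - x) (sub_nonneg.2 ht.1.le) (by linarith [ht.2])
      rw [neg_sub] at this
      rw [Real.norm_eq_abs, abs_mul, mul_div_assoc]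
      exact mul_le_mul (hK t (hsub2 ⟨ht.1.le, ht.2⟩)) this (abs_nonneg _) hK0
    · rw [intervalIntegral.integral_comp_sub_right (fun u => K * 256 / (1 + m * u) ^ 2)]
      simpa using integral_const_div_one_add_mul_sq_le hm (A := K * 256) (by positivity)
        (sub_nonneg.2 hx1)
  rw [hsplit]
  calc _ ≤ _ := abs_sub _ _
    _ ≤ K * 256 / m + K * 256 / m := add_le_add b1 b2
    _ = _ := by ring

open Polynomial in
theorem exists_polynomial_approx_of_derivWithin_le_of_pos {n : ℕ} (hn : 1 ≤ n) {f : ℝ → ℝ}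
    (hf : ContDiffOn ℝ 1 f (Set.Icc 0 1)) {K : ℝ}
    (hK : ∀ x ∈ Set.Icc (0 : ℝ) 1, |derivWithin f (Set.Icc 0 1) x| ≤ K) :
    ∃ p : ℝ[X], p.natDegree ≤ n ∧
      ∀ x ∈ Set.Icc (0 : ℝ) 1, |f x - p.eval x| ≤ 4096 * K / n := by
  obtain ⟨p, hdeg, hp⟩ := exists_polynomial_approx_of_derivWithin_le ((n - 1) / 8) hf hK
  refine ⟨p, by omega, fun x hx => (hp x hx).trans ?_⟩
  have hK0 : 0 ≤ K := (abs_nonneg _).trans (hK 0 ⟨le_rfl, zero_le_one⟩)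
  have h : n ≤ 8 * (2 * ((n - 1) / 8) + 1) := by omega
  have h' : (n : ℝ) ≤ 8 * (2 * ((n - 1) / 8 : ℕ) + 1) := by exact_mod_cast h
  have hn0 : (0 : ℝ) < n := by exact_mod_cast hn
  rw [div_le_div_iff₀ (by positivity) hn0]
  nlinarith

open Polynomial in
theorem exists_polynomial_approx_of_iteratedDerivWithin_le (s : ℕ) :
    ∃ A : ℝ, 0 < A ∧ ∀ n : ℕ, 1 ≤ n → s ≤ n → ∀ f : ℝ → ℝ,
      ContDiffOn ℝ s f (Set.Icc 0 1) → ∀ K : ℝ,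
      (∀ x ∈ Set.Icc (0 : ℝ) 1, |iteratedDerivWithin s f (Set.Icc 0 1) x| ≤ K) →
      ∃ p : ℝ[X], p.natDegree ≤ n ∧
        ∀ x ∈ Set.Icc (0 : ℝ) 1, |f x - p.eval x| ≤ A * K / n ^ s := by
  induction s with
  | zero =>
    refine ⟨1, one_pos, fun n _ _ f _ K hK => ⟨0, by simp, fun x hx => ?_⟩⟩
    simpa using hK x hx
  | succ s ih =>
    obtain ⟨A, hA, ih⟩ := ih
    refine ⟨4096 * A * 2 ^ s + 4096, by positivity, fun n hn hsn f hf K hK => ?_⟩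
    have hu : UniqueDiffOn ℝ (Set.Icc (0 : ℝ) 1) := uniqueDiffOn_Icc zero_lt_one
    have hf1 : ContDiffOn ℝ 1 f (Set.Icc 0 1) := hf.of_le (by norm_cast; omega)
    have hK0 : 0 ≤ K := (abs_nonneg _).trans (hK 0 ⟨le_rfl, zero_le_one⟩)
    rw [iteratedDerivWithin_succ'] at hK
    have hn0 : (0 : ℝ) < n := by exact_mod_cast hn
    rcases Nat.eq_zero_or_pos s with rfl | hs
    · rw [iteratedDerivWithin_zero] at hK
      obtain ⟨p, hdeg, hp⟩ := exists_polynomial_approx_of_derivWithin_le_of_pos hn hf1 hK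
      refine ⟨p, hdeg, fun x hx => (hp x hx).trans ?_⟩
      rw [zero_add, pow_one]
      gcongr
      nlinarith
    · obtain ⟨r, hrdeg, hr⟩ := ih (n - 1) (by omega) (by omega) _
        (hf.derivWithin hu (by norm_cast)) K hK
      obtain ⟨q, hq, hqdeg⟩ := exists_derivative_eq r
      have hder : ∀ x ∈ Set.Icc (0 : ℝ) 1,
          |derivWithin (fun y => f y - q.eval y) (Set.Icc 0 1) x| ≤ A * K / (n - 1 : ℕ) ^ s := by
        intro x hx
        rw [derivWithin_fun_sub ((hf1.differentiableOn one_ne_zero) x hx)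
          q.differentiableAt.differentiableWithinAt, q.derivWithin (hu x hx), hq]
        exact hr x hx
      obtain ⟨p, hdeg, hp⟩ := exists_polynomial_approx_of_derivWithin_le_of_pos hn
        (hf1.sub (contDiff_aeval q 1).contDiffOn) hder
      refine ⟨q + p, (natDegree_add_le _ _).trans (max_le (by omega) hdeg), fun x hx => ?_⟩
      have h := hp x hx
      rw [sub_sub] at h
      rw [eval_add]
      refine h.trans ?_
      have h2 : (n : ℝ) ^ s ≤ 2 ^ s * ((n - 1 : ℕ) : ℝ) ^ s := by
        rw [← mul_pow]
        exact pow_le_pow_left₀ hn0.le (by exact_mod_cast (by omega : n ≤ 2 * (n - 1))) s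
      have hn1 : (0 : ℝ) < ((n - 1 : ℕ) : ℝ) := by exact_mod_cast (by omega : 0 < n - 1)
      rw [div_le_div_iff₀ hn0 (by positivity), mul_div_assoc', div_mul_eq_mul_div,
        div_le_iff₀ (by positivity), pow_succ]
      calc 4096 * (A * K) * ((n : ℝ) ^ s * n)
          ≤ 4096 * (A * K) * (2 ^ s * ((n - 1 : ℕ) : ℝ) ^ s * n) := by gcongr
        _ = 4096 * A * 2 ^ s * K * n * ((n - 1 : ℕ) : ℝ) ^ s := by ring
        _ ≤ (4096 * A * 2 ^ s + 4096) * K * n * ((n - 1 : ℕ) : ℝ) ^ s := by gcongr; linarith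

theorem bddAbove_abs_iteratedDerivWithin {s : ℕ} {f : ℝ → ℝ}
    (hf : ContDiffOn ℝ s f (Set.Icc 0 1)) :
    BddAbove {v : ℝ | ∃ j ≤ s, ∃ x ∈ Set.Icc (0 : ℝ) 1,
      v = |iteratedDerivWithin j f (Set.Icc 0 1) x|} := by
  have h : ∀ j ∈ Set.Iic s, BddAbove
      ((fun x => |iteratedDerivWithin j f (Set.Icc 0 1) x|) '' Set.Icc 0 1) := fun j hj =>
    isCompact_Icc.bddAbove_image (hf.continuousOn_iteratedDerivWithin (by exact_mod_cast hj)
      (uniqueDiffOn_Icc zero_lt_one)).abs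
  refine (((Set.finite_Iic s).bddAbove_biUnion).2 h).mono ?_
  rintro v ⟨j, hj, x, hx, rfl⟩
  exact Set.mem_biUnion (Set.mem_Iic.2 hj) ⟨x, hx, rfl⟩

theorem sInf_uniform_error_le {n : ℕ} {f : ℝ → ℝ} {p : Polynomial ℝ} (hp : p.natDegree ≤ n)
    {b : ℝ} (hb : ∀ x ∈ Set.Icc (0 : ℝ) 1, |f x - p.eval x| ≤ b) :
    sInf {r : ℝ | ∃ p : Polynomial ℝ, p.natDegree ≤ n ∧
      r = sSup {v : ℝ | ∃ x ∈ Set.Icc (0 : ℝ) 1, v = |f x - p.eval x|}} ≤ b := by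
  refine le_trans (csInf_le ⟨0, ?_⟩ ⟨p, hp, rfl⟩) (csSup_le ?_ ?_)
  · rintro r ⟨q, -, rfl⟩
    refine Real.sSup_nonneg ?_
    rintro v ⟨x, -, rfl⟩
    exact abs_nonneg _
  · exact ⟨_, 0, ⟨le_rfl, zero_le_one⟩, rfl⟩
  · rintro v ⟨x, hx, rfl⟩
    exact hb x hx

/-- Jackson's inequality on [0,1]: for every `s ≥ 1` there is `c_s > 0`
such that for every `n ≥ 1` and every `f` with continuous derivatives up to order `s`
on `[0,1]`, `inf{‖f − p‖_∞ : deg p ≤ n} ≤ c_s · n^{−s} · max_{0≤j≤s} ‖f^{(j)}‖_∞`. -/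
theorem jackson_inequality (s : ℕ) (hs : 1 ≤ s) :
    ∃ c : ℝ, 0 < c ∧ ∀ n : ℕ, 1 ≤ n →
      ∀ f : ℝ → ℝ, ContDiffOn ℝ (s : ℕ∞) f (Set.Icc 0 1) →
        sInf {r : ℝ | ∃ p : Polynomial ℝ, p.natDegree ≤ n ∧
            r = sSup {v : ℝ | ∃ x ∈ Set.Icc (0 : ℝ) 1, v = |f x - p.eval x|}} ≤
          c * ((n : ℝ) ^ s)⁻¹ *
            sSup {v : ℝ | ∃ j ≤ s, ∃ x ∈ Set.Icc (0 : ℝ) 1,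
              v = |iteratedDerivWithin j f (Set.Icc 0 1) x|} := by
  obtain ⟨A, hA, h⟩ := exists_polynomial_approx_of_iteratedDerivWithin_le s
  refine ⟨A + s ^ s, by positivity, fun n hn f hf => ?_⟩
  have hf' : ContDiffOn ℝ s f (Set.Icc 0 1) := hf
  set M := sSup {v : ℝ | ∃ j ≤ s, ∃ x ∈ Set.Icc (0 : ℝ) 1,
    v = |iteratedDerivWithin j f (Set.Icc 0 1) x|} with hMdef
  have hM : ∀ j ≤ s, ∀ x ∈ Set.Icc (0 : ℝ) 1, |iteratedDerivWithin j f (Set.Icc 0 1) x| ≤ M :=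
    fun j hj x hx => le_csSup (bddAbove_abs_iteratedDerivWithin hf') ⟨j, hj, x, hx, rfl⟩
  have hM0 : 0 ≤ M := (abs_nonneg _).trans (hM 0 (Nat.zero_le s) 0 ⟨le_rfl, zero_le_one⟩)
  have hn0 : (0 : ℝ) < n := by exact_mod_cast hn
  rcases le_total s n with hsn | hns
  · obtain ⟨p, hdeg, hp⟩ := h n hn hsn f hf' M (hM s le_rfl)
    refine sInf_uniform_error_le hdeg fun x hx => (hp x hx).trans ?_
    rw [div_eq_mul_inv, mul_right_comm]
    gcongr
    exact le_add_of_nonneg_right (by positivity)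
  · refine sInf_uniform_error_le (p := 0) (by simp) fun x hx => ?_
    have h0 : |f x| ≤ M := by simpa using hM 0 (Nat.zero_le s) x hx
    have h1 : 1 ≤ (A + s ^ s) * ((n : ℝ) ^ s)⁻¹ := by
      rw [← div_eq_mul_inv, one_le_div (by positivity)]
      have : (n : ℝ) ^ s ≤ (s : ℝ) ^ s := by gcongr
      linarith
    simpa using h0.trans (le_mul_of_one_le_left hM0 h1)
end
end

section
/- Weighted least squares achieves the best-approximation rate in L_2 with linear oversampling: let α > 1/2 and β, C > 0. Then there exist b ∈ ℕ and c > 0, depending only on α, β, C, with the following property. Let μ be a Borel probability measure on a compact set D ⊆ ℝ^d, let (V_n)_{n∈ℕ} be subspaces of C(D) with dim V_n = n, and let F ⊆ C(D) satisfy sup_{f∈F} inf_{g∈V_n} ‖f − g‖_{L_2(μ)} ≤ C · n^{−α} (log n)^β for all n ≥ 2. Then for every n ≥ 2 there exist points x_1, …, x_{bn} ∈ D and weights w_1, …, w_{bn} > 0 such that for every f ∈ F, every g* ∈ V_n minimizing Σ_{i=1}^{bn} w_i |f(x_i) − g(x_i)|² over g ∈ V_n satisfies ‖f − g*‖_{L_2(μ)}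 ≤ c · n^{−α} (log n)^β. -/
open MeasureTheory

noncomputable section

section Barrier

open Matrix

variable {κ : Type*} [Fintype κ] [DecidableEq κ]

omit [DecidableEq κ] in
theorem Matrix.IsHermitian.dotProduct_mulVec_comm {B : Matrix κ κ ℝ} (hB : B.IsHermitian)
    (x y : κ → ℝ) : x ⬝ᵥ (B *ᵥ y) = y ⬝ᵥ (B *ᵥ x) := by
  have hT : Bᵀ = B := by simpa [Matrix.IsHermitian] using hB
  rw [dotProduct_mulVec, ← mulVec_transpose, hT, dotProduct_comm]

theorem Matrix.PosDef.mulVec_inv_mulVec {B : Matrix κ κ ℝ} (hB : B.PosDef) (v : κ → ℝ) :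
    B *ᵥ (B⁻¹ *ᵥ v) = v := by
  rw [mulVec_mulVec, mul_nonsing_inv _ ((isUnit_iff_isUnit_det _).1 hB.isUnit), one_mulVec]

theorem Matrix.PosDef.inv_mulVec_mulVec {B : Matrix κ κ ℝ} (hB : B.PosDef) (v : κ → ℝ) :
    B⁻¹ *ᵥ (B *ᵥ v) = v := by
  rw [mulVec_mulVec, nonsing_inv_mul _ ((isUnit_iff_isUnit_det _).1 hB.isUnit), one_mulVec]

/-- The Sherman-Morrison formula, at the level of traces. -/
theorem Matrix.PosDef.trace_inv_add_smul_vecMulVec {B : Matrix κ κ ℝ} (hB : B.PosDef)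
    (v : κ → ℝ) (t : ℝ) (ht : 1 + t * (v ⬝ᵥ (B⁻¹ *ᵥ v)) ≠ 0) :
    (B + t • vecMulVec v v)⁻¹.trace =
      B⁻¹.trace - t * (v ⬝ᵥ ((B⁻¹ * B⁻¹) *ᵥ v)) / (1 + t * (v ⬝ᵥ (B⁻¹ *ᵥ v))) := by
  have hdet := (isUnit_iff_isUnit_det _).1 hB.isUnit
  set q := v ⬝ᵥ (B⁻¹ *ᵥ v) with hq
  set y := B⁻¹ *ᵥ v with hy
  have hBy : B *ᵥ y = v := hB.mulVec_inv_mulVec v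
  have hvB : v ᵥ* B⁻¹ = y := by
    have hT : (B⁻¹)ᵀ = B⁻¹ := by simpa [Matrix.IsHermitian] using hB.inv.isHermitian
    rw [← mulVec_transpose, hT]
  have hinv : (B + t • vecMulVec v v)⁻¹ = B⁻¹ - (t / (1 + t * q)) • vecMulVec y y := by
    apply inv_eq_right_inv
    rw [add_mul, mul_sub, mul_sub, mul_nonsing_inv _ hdet, mul_smul_comm, mul_vecMulVec, hBy,
      smul_mul_assoc, smul_mul_assoc, mul_smul_comm, vecMulVec_mul, hvB,
      vecMulVec_mul_vecMulVec, ← hq]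
    ext i j
    simp only [Matrix.add_apply, Matrix.sub_apply, Matrix.smul_apply, vecMulVec_apply, smul_eq_mul,
      Pi.smul_apply]
    field_simp
    ring
  have hyy : v ⬝ᵥ ((B⁻¹ * B⁻¹) *ᵥ v) = y ⬝ᵥ y := by
    rw [← mulVec_mulVec, dotProduct_mulVec, hvB]
  rw [hinv, trace_sub, trace_smul, trace_vecMulVec, hyy, smul_eq_mul]
  ring

/-- Adding a multiple `t` of a rank-one projection keeps positive definiteness as long as the
Sherman-Morrison denominator stays positive. -/
theorem Matrix.PosDef.add_smul_vecMulVec {B : Matrix κ κ ℝ} (hB : B.PosDef)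
    (v : κ → ℝ) (t : ℝ) (ht : 0 < 1 + t * (v ⬝ᵥ (B⁻¹ *ᵥ v))) :
    (B + t • vecMulVec v v).PosDef := by
  have hv : (vecMulVec v v).IsHermitian := by
    ext i j; simp [vecMulVec_apply, mul_comm]
  refine PosDef.of_dotProduct_mulVec_pos (hB.isHermitian.add ?_) fun y hy => ?_
  · rw [IsHermitian, conjTranspose_smul, hv.eq, star_trivial]
  have hexp : star y ⬝ᵥ ((B + t • vecMulVec v v) *ᵥ y) =
      y ⬝ᵥ (B *ᵥ y) + t * (v ⬝ᵥ y) ^ 2 := by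
    rw [star_trivial, add_mulVec, dotProduct_add, smul_mulVec, dotProduct_smul,
      vecMulVec_mulVec, smul_eq_mul, op_smul_eq_smul, dotProduct_smul,
      dotProduct_comm y v, smul_eq_mul]
    ring
  rw [hexp]
  have hBy : 0 < y ⬝ᵥ (B *ᵥ y) := by simpa using hB.dotProduct_mulVec_pos hy
  set a := v ⬝ᵥ y with ha
  set q := v ⬝ᵥ (B⁻¹ *ᵥ v) with hq
  have hquad : 0 ≤ y ⬝ᵥ (B *ᵥ y) + 2 * t * a * a + (t * a) ^ 2 * q := by
    have h := hB.posSemidef.dotProduct_mulVec_nonneg (y + (t * a) • (B⁻¹ *ᵥ v))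
    rw [star_trivial, mulVec_add, mulVec_smul, hB.mulVec_inv_mulVec, add_dotProduct,
      dotProduct_add, dotProduct_add, smul_dotProduct, smul_dotProduct, dotProduct_smul,
      dotProduct_smul, dotProduct_comm y v, dotProduct_comm (B⁻¹ *ᵥ v) v,
      hB.isHermitian.dotProduct_mulVec_comm (B⁻¹ *ᵥ v) y, hB.mulVec_inv_mulVec,
      dotProduct_comm y v] at h
    simp only [smul_eq_mul, ← ha, ← hq] at h
    linarith
  by_cases hta : 0 ≤ t
  · positivity
  · push Not at hta
    by_cases ha0 : a = 0
    · simpa [ha0] using hBy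
    · have : 0 < -t * a ^ 2 * (1 + t * q) := by
        have := sq_pos_of_ne_zero ha0
        have : 0 < -t := by linarith
        positivity
      nlinarith

omit [DecidableEq κ] in
theorem Matrix.PosSemidef.dotProduct_mulVec_le_trace {R : Matrix κ κ ℝ} (hR : R.PosSemidef)
    (y : κ → ℝ) : y ⬝ᵥ (R *ᵥ y) ≤ R.trace * (y ⬝ᵥ y) := by
  obtain ⟨m, v, rfl⟩ := posSemidef_iff_eq_sum_vecMulVec.1 hR
  rw [trace_sum, Finset.sum_mul, sum_mulVec, dotProduct_sum]
  refine Finset.sum_le_sum fun i _ => ?_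
  rw [star_trivial, trace_vecMulVec, vecMulVec_mulVec, op_smul_eq_smul, dotProduct_smul,
    smul_eq_mul, dotProduct_comm y]
  simpa [dotProduct, ← pow_two] using Finset.sum_mul_sq_le_sq_mul_sq Finset.univ (v i) y

theorem Matrix.PosDef.sub_one_of_trace_inv_lt_one {B : Matrix κ κ ℝ} (hB : B.PosDef)
    (h : B⁻¹.trace < 1) : (B - 1).PosDef := by
  refine PosDef.of_dotProduct_mulVec_pos (hB.isHermitian.sub isHermitian_one) fun y hy => ?_
  have hyy : 0 < y ⬝ᵥ y := by simpa using dotProduct_star_self_pos_iff.2 hy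
  have h1 := hB.inv.posSemidef.dotProduct_mulVec_nonneg (B *ᵥ y - y)
  have h2 := hB.inv.posSemidef.dotProduct_mulVec_le_trace y
  rw [star_trivial, mulVec_sub, hB.inv_mulVec_mulVec, sub_dotProduct, dotProduct_sub,
    dotProduct_sub, dotProduct_comm (B *ᵥ y) y,
    hB.inv.isHermitian.dotProduct_mulVec_comm (B *ᵥ y) y, hB.inv_mulVec_mulVec] at h1
  rw [star_trivial, sub_mulVec, dotProduct_sub, one_mulVec]
  nlinarith

theorem Matrix.inv_sub_inv_add_smul_one {B : Matrix κ κ ℝ} {δ : ℝ} (hB : IsUnit B)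
    (hB' : IsUnit (B + δ • (1 : Matrix κ κ ℝ))) :
    B⁻¹ - (B + δ • 1)⁻¹ = δ • (B⁻¹ * (B + δ • 1)⁻¹) ∧
      B⁻¹ - (B + δ • 1)⁻¹ = δ • ((B + δ • 1)⁻¹ * B⁻¹) := by
  have h := (isUnit_iff_isUnit_det _).1 hB
  have h' := (isUnit_iff_isUnit_det _).1 hB'
  set B' := B + δ • (1 : Matrix κ κ ℝ) with hdef
  have hd : δ • (1 : Matrix κ κ ℝ) = B' - B := by rw [hdef]; abel
  constructor
  · calc B⁻¹ - B'⁻¹ = B⁻¹ * (B' - B) * B'⁻¹ := by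
          rw [mul_sub, sub_mul, nonsing_inv_mul _ h, mul_assoc, mul_nonsing_inv _ h', mul_one,
            one_mul]
      _ = _ := by rw [← hd]; simp
  · calc B⁻¹ - B'⁻¹ = B'⁻¹ * (B' - B) * B⁻¹ := by
          rw [mul_sub, sub_mul, nonsing_inv_mul _ h', mul_assoc, mul_nonsing_inv _ h, mul_one,
            one_mul]
      _ = _ := by rw [← hd]; simp

theorem Matrix.PosDef.trace_inv_mul_inv_add_smul_one {B : Matrix κ κ ℝ} {δ : ℝ}
    (hB : B.PosDef) (hB' : (B + δ • (1 : Matrix κ κ ℝ)).PosDef) :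
    B⁻¹.trace - (B + δ • 1)⁻¹.trace = δ * (B⁻¹ * (B + δ • 1)⁻¹).trace ∧
    (B⁻¹ * (B + δ • 1)⁻¹).trace = ((B + δ • 1)⁻¹ * (B + δ • 1)⁻¹).trace +
        δ * ((B + δ • 1)⁻¹ * B⁻¹ * (B + δ • 1)⁻¹).trace ∧
    (B⁻¹ * B⁻¹).trace = (B⁻¹ * (B + δ • 1)⁻¹).trace +
        δ * (B⁻¹ * (B + δ • 1)⁻¹ * B⁻¹).trace := by
  obtain ⟨h1, h2⟩ := inv_sub_inv_add_smul_one hB.isUnit hB'.isUnit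
  refine ⟨?_, ?_, ?_⟩
  · rw [← trace_sub, h1, trace_smul, smul_eq_mul]
  · rw [← smul_eq_mul (a := δ), ← trace_smul, ← smul_mul_assoc, ← h2, ← trace_add, sub_mul]
    congr 1; abel
  · rw [← smul_eq_mul (a := δ), ← trace_smul, mul_assoc, ← mul_smul_comm, ← h2, ← trace_add, mul_sub]
    congr 1; abel

omit [DecidableEq κ] in
theorem Matrix.PosSemidef.trace_conj_nonneg {P M : Matrix κ κ ℝ} (hP : P.PosSemidef)
    (hM : M.IsHermitian) : 0 ≤ (M * P * M).trace := by
  have h := (hP.conjTranspose_mul_mul_same M).trace_nonneg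
  rwa [hM.eq] at h

theorem Matrix.PosDef.trace_mul_self_pos [Nonempty κ] {M : Matrix κ κ ℝ} (hM : M.PosDef) :
    0 < (M * M).trace := by
  have h := (PosDef.conjTranspose_mul_self M (mulVec_injective_of_isUnit hM.isUnit)).trace_pos
  rwa [hM.isHermitian.eq] at h

/-- The quantity that `1 / s` has to dominate so that moving the upper barrier by `δ` pays for
adding `s • vecMulVec v v`; here `B` is the gap between the barrier and the current matrix. -/
def upperGain (B : Matrix κ κ ℝ) (δ : ℝ) (v : κ → ℝ) : ℝ :=
  v ⬝ᵥ ((B + δ • 1)⁻¹ *ᵥ v) +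
    v ⬝ᵥ (((B + δ • 1)⁻¹ * (B + δ • 1)⁻¹) *ᵥ v) / (B⁻¹.trace - (B + δ • 1)⁻¹.trace)

/-- The quantity that `1 / s` must not exceed so that adding `s • vecMulVec v v` pays for moving
the lower barrier by `1`; here `B` is the gap between the current matrix and the new barrier. -/
def lowerGain (B : Matrix κ κ ℝ) (v : κ → ℝ) : ℝ :=
  v ⬝ᵥ ((B⁻¹ * B⁻¹) *ᵥ v) / (B⁻¹.trace - (B + (1 : ℝ) • 1)⁻¹.trace) - v ⬝ᵥ (B⁻¹ *ᵥ v)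

omit [Fintype κ] in
theorem posDef_add_smul_one {B : Matrix κ κ ℝ} (hB : B.PosDef) {δ : ℝ} (hδ : 0 < δ) :
    (B + δ • (1 : Matrix κ κ ℝ)).PosDef :=
  hB.add (PosDef.one.smul hδ)

theorem trace_inv_sub_pos [Nonempty κ] {B : Matrix κ κ ℝ} (hB : B.PosDef) {δ : ℝ} (hδ : 0 < δ) :
    0 < B⁻¹.trace - (B + δ • 1)⁻¹.trace := by
  have hB' := posDef_add_smul_one hB hδ
  obtain ⟨h1, h2, -⟩ := hB.trace_inv_mul_inv_add_smul_one hB'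
  rw [h1, h2]
  have := hB'.inv.trace_mul_self_pos
  have := hB.inv.posSemidef.trace_conj_nonneg hB'.inv.isHermitian
  positivity

omit [DecidableEq κ] in
theorem dotProduct_mul_self_mulVec_nonneg {M : Matrix κ κ ℝ} (hM : M.IsHermitian) (v : κ → ℝ) :
    0 ≤ v ⬝ᵥ ((M * M) *ᵥ v) := by
  have h := posSemidef_conjTranspose_mul_self M
  rw [hM.eq] at h
  simpa using h.dotProduct_mulVec_nonneg v

theorem upperGain_nonneg {B : Matrix κ κ ℝ} (hB : B.PosDef) {δ : ℝ} (hδ : 0 < δ) (v : κ → ℝ) :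
    0 ≤ upperGain B δ v := by
  rcases isEmpty_or_nonempty κ with h | h
  · simp [upperGain, dotProduct]
  have hB' := posDef_add_smul_one hB hδ
  have h1 : 0 ≤ v ⬝ᵥ ((B + δ • 1)⁻¹ *ᵥ v) := by
    simpa using hB'.inv.posSemidef.dotProduct_mulVec_nonneg v
  have h2 := dotProduct_mul_self_mulVec_nonneg hB'.inv.isHermitian v
  exact add_nonneg h1 (div_nonneg h2 (trace_inv_sub_pos hB hδ).le)

theorem upperGain_spec {B : Matrix κ κ ℝ} (hB : B.PosDef) {δ s : ℝ} (hδ : 0 < δ) (hs : 0 < s)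
    {v : κ → ℝ} (hv : s * upperGain B δ v < 1) :
    (B + δ • 1 - s • vecMulVec v v).PosDef ∧
      (B + δ • 1 - s • vecMulVec v v)⁻¹.trace ≤ B⁻¹.trace := by
  rcases isEmpty_or_nonempty κ with h | h
  · exact ⟨by convert hB; ext i; exact h.elim i, by simp [trace]⟩
  have hB' := posDef_add_smul_one hB hδ
  have hτ := trace_inv_sub_pos hB hδ
  have h2 := dotProduct_mul_self_mulVec_nonneg hB'.inv.isHermitian v
  have hU : upperGain B δ v = v ⬝ᵥ ((B + δ • 1)⁻¹ *ᵥ v) +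
    v ⬝ᵥ (((B + δ • 1)⁻¹ * (B + δ • 1)⁻¹) *ᵥ v) / (B⁻¹.trace - (B + δ • 1)⁻¹.trace) := rfl
  set q := v ⬝ᵥ ((B + δ • 1)⁻¹ *ᵥ v)
  set r := v ⬝ᵥ (((B + δ • 1)⁻¹ * (B + δ • 1)⁻¹) *ᵥ v)
  set τ := B⁻¹.trace - (B + δ • 1)⁻¹.trace with hτdef
  have hr : 0 ≤ r / τ := div_nonneg h2 hτ.le
  have hden : 0 < 1 + -s * q := by nlinarith [mul_nonneg hs.le hr]
  have h3 := hB'.trace_inv_add_smul_vecMulVec v (-s) hden.ne'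
  rw [sub_eq_add_neg, ← neg_smul]
  refine ⟨hB'.add_smul_vecMulVec v (-s) hden, ?_⟩
  rw [h3]
  have : s * r / (1 + -s * q) ≤ τ := by
    rw [div_le_iff₀ hden]
    have : s * (r / τ) ≤ 1 + -s * q := by nlinarith
    calc s * r = τ * (s * (r / τ)) := by field_simp
      _ ≤ _ := by gcongr
  have e : -s * r / (1 + -s * q) = -(s * r / (1 + -s * q)) := by ring
  rw [e]
  linarith

theorem lowerGain_spec [Nonempty κ] {B : Matrix κ κ ℝ} (hB : B.PosDef) {s : ℝ} (hs : 0 < s)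
    {v : κ → ℝ} (hv : 1 ≤ s * lowerGain B v) :
    (B + s • vecMulVec v v).PosDef ∧
      (B + s • vecMulVec v v)⁻¹.trace ≤ (B + (1 : ℝ) • 1)⁻¹.trace := by
  have hτ := trace_inv_sub_pos hB one_pos
  have hL : lowerGain B v = v ⬝ᵥ ((B⁻¹ * B⁻¹) *ᵥ v) /
    (B⁻¹.trace - (B + (1 : ℝ) • 1)⁻¹.trace) - v ⬝ᵥ (B⁻¹ *ᵥ v) := rfl
  have hq : 0 ≤ v ⬝ᵥ (B⁻¹ *ᵥ v) := by
    simpa using hB.inv.posSemidef.dotProduct_mulVec_nonneg v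
  set q := v ⬝ᵥ (B⁻¹ *ᵥ v)
  set r := v ⬝ᵥ ((B⁻¹ * B⁻¹) *ᵥ v)
  set τ := B⁻¹.trace - (B + (1 : ℝ) • 1)⁻¹.trace with hτdef
  have hden : 0 < 1 + s * q := by positivity
  refine ⟨hB.add_smul_vecMulVec v s hden, ?_⟩
  rw [hB.trace_inv_add_smul_vecMulVec v s hden.ne']
  have : τ ≤ s * r / (1 + s * q) := by
    rw [le_div_iff₀ hden]
    have : 1 + s * q ≤ s * (r / τ) := by rw [hL] at hv; linarith
    calc τ * (1 + s * q) ≤ τ * (s * (r / τ)) := by gcongr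
      _ = s * r := by field_simp
  linarith

theorem upperGain_trace_le {B : Matrix κ κ ℝ} (hB : B.PosDef) {δ : ℝ} (hδ : 0 < δ) :
    (B + δ • 1)⁻¹.trace +
      ((B + δ • 1)⁻¹ * (B + δ • 1)⁻¹).trace / (B⁻¹.trace - (B + δ • 1)⁻¹.trace) ≤
    B⁻¹.trace + 1 / δ := by
  rcases isEmpty_or_nonempty κ with h | h
  · simp [trace, hδ.le]
  have hB' := posDef_add_smul_one hB hδ
  have hτ := trace_inv_sub_pos hB hδ
  obtain ⟨h1, h2, -⟩ := hB.trace_inv_mul_inv_add_smul_one hB'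
  have := hB.inv.posSemidef.trace_conj_nonneg hB'.inv.isHermitian
  refine add_le_add (by linarith) ?_
  rw [div_le_div_iff₀ hτ hδ, h1]
  nlinarith [mul_nonneg hδ.le this]

theorem le_lowerGain_trace [Nonempty κ] {B : Matrix κ κ ℝ} (hB : B.PosDef)
    (h : (B + (1 : ℝ) • 1)⁻¹.trace ≤ 1) :
    1 - (B + (1 : ℝ) • 1)⁻¹.trace ≤
      (B⁻¹ * B⁻¹).trace / (B⁻¹.trace - (B + (1 : ℝ) • 1)⁻¹.trace) - B⁻¹.trace := by
  have hB' := posDef_add_smul_one hB one_pos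
  have hτ := trace_inv_sub_pos hB one_pos
  obtain ⟨h1, -, h3⟩ := hB.trace_inv_mul_inv_add_smul_one hB'
  set P := (B + (1 : ℝ) • (1 : Matrix κ κ ℝ))⁻¹ with hP
  set τ := B⁻¹.trace - P.trace with hτdef
  have h4 : 0 ≤ (B⁻¹ * P * B⁻¹).trace - 2 * τ * τ + τ ^ 2 * P.trace := by
    have h5 := hB'.inv.posSemidef.trace_conj_nonneg (M := B⁻¹ - τ • 1)
      (hB.inv.isHermitian.sub (isHermitian_one.smul (by rfl)))
    simp only [sub_mul, mul_sub, smul_mul_assoc, one_mul, mul_smul_comm, mul_one, trace_sub,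
      trace_smul, smul_eq_mul, ← hP] at h5
    rw [trace_mul_comm P B⁻¹] at h5
    nlinarith
  have h6 : 1 + τ ≤ (B⁻¹ * B⁻¹).trace / τ := by
    rw [le_div_iff₀ hτ, h3, ← one_mul (B⁻¹ * P).trace, ← h1]
    nlinarith [sq_nonneg τ]
  linarith

end Barrier

section Sparsification

open Matrix

variable {X : Type*} [MeasurableSpace X]

/-- The vector field `v` has second moment matrix equal to the identity. -/
def IsIsotropic {κ : Type*} [DecidableEq κ] (μ : Measure X) (v : X → κ → ℝ) : Prop :=
  ∀ i j, Integrable (fun x => v x i * v x j) μ ∧ ∫ x, v x i * v x j ∂μ = (1 : Matrix κ κ ℝ) i j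

theorem trace_inv_smul_one {κ : Type*} [Fintype κ] [DecidableEq κ] {c : ℝ} (hc : c ≠ 0) :
    (c • (1 : Matrix κ κ ℝ))⁻¹.trace = Fintype.card κ / c := by
  rw [inv_eq_right_inv (B := c⁻¹ • 1) (by simp [hc])]
  simp [div_eq_inv_mul]

section

variable {κ : Type*} [Fintype κ] [DecidableEq κ] {μ : Measure X} {v : X → κ → ℝ}

omit [MeasurableSpace X] [DecidableEq κ] in
theorem dotProduct_mulVec_eq_sum (M : Matrix κ κ ℝ) (y : κ → ℝ) :
    y ⬝ᵥ (M *ᵥ y) = ∑ i, ∑ j, M i j * (y i * y j) := by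
  simp only [dotProduct, mulVec, Finset.mul_sum]
  exact Finset.sum_congr rfl fun i _ => Finset.sum_congr rfl fun j _ => by ring

theorem IsIsotropic.integrable (hv : IsIsotropic μ v) (M : Matrix κ κ ℝ) :
    Integrable (fun x => v x ⬝ᵥ (M *ᵥ v x)) μ := by
  simp only [dotProduct_mulVec_eq_sum]
  exact integrable_finsetSum _ fun i _ => integrable_finsetSum _ fun j _ =>
    (hv i j).1.const_mul _

theorem IsIsotropic.integral_eq (hv : IsIsotropic μ v) (M : Matrix κ κ ℝ) :
    ∫ x, v x ⬝ᵥ (M *ᵥ v x) ∂μ = M.trace := by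
  simp only [dotProduct_mulVec_eq_sum]
  have h : ∀ i j, Integrable (fun x => M i j * (v x i * v x j)) μ := fun i j =>
    (hv i j).1.const_mul _
  rw [integral_finsetSum _ fun i _ => integrable_finsetSum _ fun j _ => h i j]
  refine Finset.sum_congr rfl fun i _ => ?_
  rw [integral_finsetSum _ fun j _ => h i j]
  simp_rw [integral_const_mul, (hv i _).2, one_apply]
  simp

theorem IsIsotropic.upperGain (hv : IsIsotropic μ v) {B : Matrix κ κ ℝ} (hB : B.PosDef)
    {δ : ℝ} (hδ : 0 < δ) :
    Integrable (fun x => upperGain B δ (v x)) μ ∧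
      ∫ x, upperGain B δ (v x) ∂μ ≤ B⁻¹.trace + 1 / δ := by
  have h1 := hv.integrable (B + δ • 1)⁻¹
  have h2 := (hv.integrable ((B + δ • 1)⁻¹ * (B + δ • 1)⁻¹)).div_const
    (B⁻¹.trace - (B + δ • 1)⁻¹.trace)
  refine ⟨h1.add h2, ?_⟩
  simp only [_root_.upperGain]
  rw [integral_add h1 h2, integral_div, hv.integral_eq, hv.integral_eq]
  exact upperGain_trace_le hB hδ

theorem IsIsotropic.lowerGain [Nonempty κ] (hv : IsIsotropic μ v) {B : Matrix κ κ ℝ}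
    (hB : B.PosDef) (h : (B + (1 : ℝ) • 1)⁻¹.trace ≤ 1) :
    Integrable (fun x => lowerGain B (v x)) μ ∧
      1 - (B + (1 : ℝ) • 1)⁻¹.trace ≤ ∫ x, lowerGain B (v x) ∂μ := by
  have h1 := hv.integrable B⁻¹
  have h2 := (hv.integrable (B⁻¹ * B⁻¹)).div_const (B⁻¹.trace - (B + (1 : ℝ) • 1)⁻¹.trace)
  refine ⟨h2.sub h1, ?_⟩
  simp only [_root_.lowerGain]
  rw [integral_sub h2 h1, integral_div, hv.integral_eq, hv.integral_eq]
  exact le_lowerGain_trace hB h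

end

variable {ι κ₀ : Type*} [Fintype ι] [Fintype κ₀] [DecidableEq κ₀] [Nonempty κ₀]
  {κ : ι → Type*} [∀ k, Fintype (κ k)] [∀ k, DecidableEq (κ k)]
  {μ : Measure X} {a : X → κ₀ → ℝ} {e : ∀ k, X → κ k → ℝ}
  {S : Set X} {p : ι → ℝ}

/-- One step of the barrier method, with one lower barrier and a family of upper barriers. -/
theorem exists_barrier_step (hS : S ∈ ae μ) (ha : IsIsotropic μ a)
    (he : ∀ k, IsIsotropic μ (e k)) (hp : ∀ k, 0 < p k) (hsum : ∑ k, p k < 3 / 8)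
    {A : Matrix κ₀ κ₀ ℝ} {B : ∀ k, Matrix (κ k) (κ k) ℝ} (hA : A.PosDef)
    (hAt : A⁻¹.trace ≤ 1 / 4) (hB : ∀ k, (B k).PosDef) (hBt : ∀ k, (B k)⁻¹.trace ≤ p k) :
    ∃ x ∈ S, ∃ s : ℝ, 0 < s ∧
      ((A - 1 + s • vecMulVec (a x) (a x)).PosDef ∧
        (A - 1 + s • vecMulVec (a x) (a x))⁻¹.trace ≤ 1 / 4) ∧
      ∀ k, (B k + (1 / p k) • 1 - s • vecMulVec (e k x) (e k x)).PosDef ∧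
        (B k + (1 / p k) • 1 - s • vecMulVec (e k x) (e k x))⁻¹.trace ≤ p k := by
  have hA' : (A - 1).PosDef := hA.sub_one_of_trace_inv_lt_one (by linarith)
  have hAA : A - 1 + (1 : ℝ) • (1 : Matrix κ₀ κ₀ ℝ) = A := by simp
  have hδ : ∀ k, 0 < 1 / p k := fun k => one_div_pos.2 (hp k)
  obtain ⟨hLi, hLe⟩ := ha.lowerGain hA' (by rw [hAA]; linarith)
  rw [hAA] at hLe
  have hU := fun k => (he k).upperGain (hB k) (hδ k)
  have hUi : Integrable (fun x => ∑ k, upperGain (B k) (1 / p k) (e k x)) μ :=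
    integrable_finsetSum _ fun k _ => (hU k).1
  have hUe : ∫ x, ∑ k, upperGain (B k) (1 / p k) (e k x) ∂μ ≤ 2 * ∑ k, p k := by
    rw [integral_finsetSum _ fun k _ => (hU k).1, Finset.mul_sum]
    refine Finset.sum_le_sum fun k _ => (hU k).2.trans ?_
    rw [one_div_one_div]
    linarith [hBt k]
  obtain ⟨x, hxS, hx⟩ : ∃ x ∈ S,
      ∑ k, upperGain (B k) (1 / p k) (e k x) < lowerGain (A - 1) (a x) := by
    by_contra! hcon
    have := integral_mono_ae hLi hUi (Filter.mem_of_superset hS hcon)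
    linarith
  have hUx : ∀ k, 0 ≤ upperGain (B k) (1 / p k) (e k x) := fun k =>
    upperGain_nonneg (hB k) (hδ k) _
  have hL : 0 < lowerGain (A - 1) (a x) :=
    (Finset.sum_nonneg fun k _ => hUx k).trans_lt hx
  have hs := inv_pos.2 hL
  refine ⟨x, hxS, (lowerGain (A - 1) (a x))⁻¹, hs, ?_, fun k => ?_⟩
  · obtain ⟨h1, h2⟩ := lowerGain_spec hA' hs (inv_mul_cancel₀ hL.ne').ge
    rw [hAA] at h2
    exact ⟨h1, h2.trans hAt⟩
  · have hk : upperGain (B k) (1 / p k) (e k x) < lowerGain (A - 1) (a x) :=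
      (Finset.single_le_sum (fun k _ => hUx k) (Finset.mem_univ k)).trans_lt hx
    obtain ⟨h1, h2⟩ := upperGain_spec (hB k) (hδ k) hs (v := e k x)
      (by rwa [inv_mul_lt_iff₀ hL, mul_one])
    exact ⟨h1, h2.trans (hBt k)⟩

/-- Weighted sparsification of the identity, two-sided for `a` and from above for each `e k`. -/
theorem exists_barrier_points (hS : S ∈ ae μ) (ha : IsIsotropic μ a)
    (he : ∀ k, IsIsotropic μ (e k)) (hp : ∀ k, 0 < p k) (hsum : ∑ k, p k < 3 / 8)
    {n : ℕ} (hn : Fintype.card κ₀ ≤ n) {m : ι → ℕ} (hm0 : ∀ k, 0 < m k)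
    (hm : ∀ k, Fintype.card (κ k) ≤ m k) (N : ℕ) :
    ∃ (x : Fin N → X) (s : Fin N → ℝ), (∀ i, x i ∈ S) ∧ (∀ i, 0 < s i) ∧
      ((4 * n - N : ℝ) • (1 : Matrix κ₀ κ₀ ℝ) +
          ∑ i, s i • vecMulVec (a (x i)) (a (x i))).PosDef ∧
      ((4 * n - N : ℝ) • (1 : Matrix κ₀ κ₀ ℝ) +
          ∑ i, s i • vecMulVec (a (x i)) (a (x i)))⁻¹.trace ≤ 1 / 4 ∧
      ∀ k, (((m k + N) / p k : ℝ) • (1 : Matrix (κ k) (κ k) ℝ) -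
          ∑ i, s i • vecMulVec (e k (x i)) (e k (x i))).PosDef ∧
        (((m k + N) / p k : ℝ) • (1 : Matrix (κ k) (κ k) ℝ) -
          ∑ i, s i • vecMulVec (e k (x i)) (e k (x i)))⁻¹.trace ≤ p k := by
  induction N with
  | zero =>
    have hn0 : (0 : ℝ) < n := by exact_mod_cast Fintype.card_pos.trans_le hn
    refine ⟨Fin.elim0, Fin.elim0, fun i => i.elim0, fun i => i.elim0, ?_, ?_, fun k => ⟨?_, ?_⟩⟩
    · simpa using PosDef.one.smul (by positivity : (0 : ℝ) < 4 * n)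
    · have : (Fintype.card κ₀ : ℝ) ≤ n := by exact_mod_cast hn
      simp only [Finset.univ_eq_empty, Finset.sum_empty, add_zero, Nat.cast_zero, sub_zero]
      rw [trace_inv_smul_one (by positivity), div_le_div_iff₀ (by positivity) (by positivity)]
      linarith
    · have := hp k
      have := hm0 k
      simpa using PosDef.one.smul (by positivity : (0 : ℝ) < m k / p k)
    · have := hp k
      have h0 := hm0 k
      have : (Fintype.card (κ k) : ℝ) ≤ m k := by exact_mod_cast hm k
      simp only [Finset.univ_eq_empty, Finset.sum_empty, add_zero, Nat.cast_zero, sub_zero]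
      rw [trace_inv_smul_one (by positivity), div_le_iff₀ (by positivity)]
      field_simp
      exact this
  | succ N ih =>
    obtain ⟨x, s, hxS, hs, hA, hAt, hB⟩ := ih
    obtain ⟨y, hyS, t, ht, ⟨hA', hAt'⟩, hB'⟩ := exists_barrier_step hS ha he hp hsum hA hAt
      (fun k => (hB k).1) (fun k => (hB k).2)
    have eA : (4 * n - (N + 1 : ℕ) : ℝ) • (1 : Matrix κ₀ κ₀ ℝ) +
        ∑ i, (Fin.snoc s t : Fin (N + 1) → ℝ) i •
          vecMulVec (a ((Fin.snoc x y : Fin (N + 1) → X) i))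
            (a ((Fin.snoc x y : Fin (N + 1) → X) i)) =
        (4 * n - N : ℝ) • (1 : Matrix κ₀ κ₀ ℝ) + ∑ i, s i • vecMulVec (a (x i)) (a (x i)) - 1 +
          t • vecMulVec (a y) (a y) := by
      simp only [Fin.sum_univ_castSucc, Fin.snoc_castSucc, Fin.snoc_last]
      push_cast
      module
    have eB : ∀ k, ((m k + (N + 1 : ℕ)) / p k : ℝ) • (1 : Matrix (κ k) (κ k) ℝ) -
        ∑ i, (Fin.snoc s t : Fin (N + 1) → ℝ) i •
          vecMulVec (e k ((Fin.snoc x y : Fin (N + 1) → X) i))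
            (e k ((Fin.snoc x y : Fin (N + 1) → X) i)) =
        ((m k + N) / p k : ℝ) • (1 : Matrix (κ k) (κ k) ℝ) -
          ∑ i, s i • vecMulVec (e k (x i)) (e k (x i)) + (1 / p k) • 1 -
          t • vecMulVec (e k y) (e k y) := by
      intro k
      simp only [Fin.sum_univ_castSucc, Fin.snoc_castSucc, Fin.snoc_last]
      push_cast
      module
    refine ⟨Fin.snoc x y, Fin.snoc s t, ?_, ?_, ?_, ?_, fun k => ⟨?_, ?_⟩⟩
    · intro i
      induction i using Fin.lastCases with
      | last => simpa using hyS
      | cast i => simpa using hxS i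
    · intro i
      induction i using Fin.lastCases with
      | last => simpa using ht
      | cast i => simpa using hs i
    · rwa [eA]
    · rwa [eA]
    · rw [eB]; exact (hB' k).1
    · rw [eB]; exact (hB' k).2

end Sparsification

section Discretization

open Matrix

variable {X : Type*} [TopologicalSpace X] [CompactSpace X] [MeasurableSpace X] [BorelSpace X]

/-- The class of a continuous function in `L²(μ)`. -/
abbrev toL2 (μ : Measure X) [IsFiniteMeasure μ] : C(X, ℝ) →L[ℝ] Lp ℝ 2 μ :=
  ContinuousMap.toLp 2 μ ℝ

omit [CompactSpace X] [BorelSpace X] in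
theorem eq_of_ae_eq_of_mem_support {μ : Measure X} {f g : X → ℝ} (hf : Continuous f)
    (hg : Continuous g) (h : f =ᵐ[μ] g) {x : X} (hx : x ∈ μ.support) : f x = g x := by
  by_contra hne
  have hU : {y | f y ≠ g y} ∈ nhds x := (isOpen_ne_fun hf hg).mem_nhds hne
  exact ((Measure.mem_support_iff_forall x).1 hx _ hU).ne' h

theorem exists_isotropic_frame (μ : Measure X) [IsFiniteMeasure μ] (W : Submodule ℝ C(X, ℝ))
    [FiniteDimensional ℝ W] :
    ∃ (m : ℕ) (e : Fin m → C(X, ℝ)), m ≤ Module.finrank ℝ W ∧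
      IsIsotropic μ (fun x i => e i x) ∧
      ∀ h ∈ W, ∃ c : Fin m → ℝ, c ⬝ᵥ c = ‖toL2 μ h‖ ^ 2 ∧
        ∀ x ∈ μ.support, h x = (fun i => e i x) ⬝ᵥ c := by
  set U := W.map (toL2 μ : C(X, ℝ) →ₗ[ℝ] Lp ℝ 2 μ) with hU
  let b := stdOrthonormalBasis ℝ U
  have hb : ∀ i, ∃ e : C(X, ℝ), toL2 μ e = b i := fun i => by
    obtain ⟨e, -, he⟩ := (b i).2
    exact ⟨e, he⟩
  choose e he using hb
  refine ⟨_, e, Submodule.finrank_map_le _ W, fun i j => ⟨?_, ?_⟩, fun h hh => ?_⟩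
  · exact ((e i).continuous.mul (e j).continuous).integrable_of_hasCompactSupport
      (HasCompactSupport.of_compactSpace _)
  · have h1 := ContinuousMap.inner_toLp μ (e i) (e j) (𝕜 := ℝ)
    rw [show ContinuousMap.toLp 2 μ ℝ (e i) = _ from he i,
      show ContinuousMap.toLp 2 μ ℝ (e j) = _ from he j, ← Submodule.coe_inner,
      orthonormal_iff_ite.1 b.orthonormal i j] at h1
    simp only [conj_trivial] at h1
    rw [one_apply, h1]
    congr 1
    ext x
    ring
  · let y : U := ⟨toL2 μ h, h, hh, rfl⟩
    refine ⟨b.repr y, ?_, fun x hx => ?_⟩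
    · have h1 : ‖b.repr y‖ = ‖toL2 μ h‖ := b.repr.norm_map y
      rw [← h1, EuclideanSpace.norm_sq_eq]
      simp [dotProduct, pow_two]
    · have h2 : toL2 μ h = toL2 μ (∑ i, b.repr y i • e i) := by
        have h3 := congrArg Subtype.val (b.sum_repr y)
        rw [map_sum]
        simp_rw [map_smul, he]
        rw [← show (y : Lp ℝ 2 μ) = toL2 μ h from rfl, ← h3]
        simp
      have h4 : (h : X → ℝ) =ᵐ[μ] (∑ i, b.repr y i • e i : C(X, ℝ)) := by
        refine (ContinuousMap.coeFn_toLp (p := 2) (𝕜 := ℝ) μ h).symm.trans ?_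
        rw [show ContinuousMap.toLp 2 μ ℝ h = _ from h2]
        exact ContinuousMap.coeFn_toLp (p := 2) (𝕜 := ℝ) μ _
      rw [eq_of_ae_eq_of_mem_support h.continuous (ContinuousMap.continuous _) h4 hx]
      simp [dotProduct, mul_comm, ContinuousMap.sum_apply]

theorem dotProduct_smul_one_add_sum {κ : Type*} [Fintype κ] [DecidableEq κ] {N : ℕ} (r : ℝ)
    (s : Fin N → ℝ) (v : Fin N → κ → ℝ) (y : κ → ℝ) :
    y ⬝ᵥ ((r • (1 : Matrix κ κ ℝ) + ∑ i, s i • vecMulVec (v i) (v i)) *ᵥ y) =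
      r * (y ⬝ᵥ y) + ∑ i, s i * (v i ⬝ᵥ y) ^ 2 := by
  rw [add_mulVec, dotProduct_add, smul_mulVec, one_mulVec, dotProduct_smul, smul_eq_mul,
    sum_mulVec, dotProduct_sum]
  congr 1
  refine Finset.sum_congr rfl fun i _ => ?_
  rw [smul_mulVec, vecMulVec_mulVec, op_smul_eq_smul, dotProduct_smul, dotProduct_smul,
    smul_eq_mul, smul_eq_mul, dotProduct_comm y]
  ring

/-- Points and weights which discretize the `L²` norm from below on `V` and from above on each
`W k`. -/
theorem exists_discretization [SecondCountableTopology X] (μ : Measure X)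
    [IsProbabilityMeasure μ] {ι : Type*} [Fintype ι] (V : Submodule ℝ C(X, ℝ))
    [FiniteDimensional ℝ V] (hV : 1 ∈ V) {n : ℕ} (hn : Module.finrank ℝ V ≤ n)
    (W : ι → Submodule ℝ C(X, ℝ)) [∀ k, FiniteDimensional ℝ (W k)] {m : ι → ℕ}
    (hm0 : ∀ k, 0 < m k) (hm : ∀ k, Module.finrank ℝ (W k) ≤ m k) {p : ι → ℝ}
    (hp : ∀ k, 0 < p k) (hsum : ∑ k, p k < 3 / 8) (N : ℕ) :
    ∃ (x : Fin N → X) (s : Fin N → ℝ), (∀ i, x i ∈ μ.support) ∧ (∀ i, 0 < s i) ∧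
      (∀ g ∈ V, (N - 4 * n : ℝ) * ‖toL2 μ g‖ ^ 2 ≤ ∑ i, s i * g (x i) ^ 2) ∧
      ∀ k, ∀ h ∈ W k, ∑ i, s i * h (x i) ^ 2 ≤ (m k + N) / p k * ‖toL2 μ h‖ ^ 2 := by
  obtain ⟨m₀, a, hm₀, ha, haV⟩ := exists_isotropic_frame μ V
  choose d e hd he heW using fun k => exists_isotropic_frame μ (W k)
  have : Nonempty (Fin m₀) := by
    obtain ⟨x, hx⟩ := Measure.nonempty_support (IsProbabilityMeasure.ne_zero μ)
    obtain ⟨c, -, hc⟩ := haV 1 hV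
    by_contra hemp
    rw [not_nonempty_iff] at hemp
    simpa [dotProduct] using hc x hx
  obtain ⟨x, s, hx, hs, hA, -, hB⟩ := exists_barrier_points Measure.support_mem_ae ha he hp hsum
    (by simpa using hm₀.trans hn) hm0 (fun k => by simpa using (hd k).trans (hm k)) N
  refine ⟨x, s, hx, hs, fun g hg => ?_, fun k h hh => ?_⟩
  · obtain ⟨c, hc, hgc⟩ := haV g hg
    have h1 := hA.posSemidef.dotProduct_mulVec_nonneg c
    rw [star_trivial, dotProduct_smul_one_add_sum, hc] at h1
    simp_rw [fun i => hgc (x i) (hx i)]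
    linarith
  · obtain ⟨c, hc, hgc⟩ := heW k h hh
    have h1 := (hB k).1.posSemidef.dotProduct_mulVec_nonneg c
    rw [sub_eq_add_neg, ← Finset.sum_neg_distrib] at h1
    simp_rw [← neg_smul] at h1
    rw [star_trivial, dotProduct_smul_one_add_sum, hc] at h1
    simp_rw [fun i => hgc (x i) (hx i)]
    simp only [neg_mul, Finset.sum_neg_distrib] at h1
    linarith

end Discretization

section DiscreteNorm

variable {X : Type*} {N : ℕ} {w : Fin N → ℝ} {x : Fin N → X}

/-- The weighted discrete `ℓ²` seminorm of a function. -/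
def discreteNorm (w : Fin N → ℝ) (x : Fin N → X) (h : X → ℝ) : ℝ :=
  √(∑ i, w i * h (x i) ^ 2)

theorem discreteNorm_eq_norm (hw : ∀ i, 0 ≤ w i) (h : X → ℝ) :
    discreteNorm w x h = ‖WithLp.toLp 2 (fun i => √(w i) * h (x i))‖ := by
  rw [discreteNorm, EuclideanSpace.norm_eq]
  congr 1
  refine Finset.sum_congr rfl fun i _ => ?_
  rw [Real.norm_eq_abs, sq_abs, mul_pow, Real.sq_sqrt (hw i)]

theorem discreteNorm_add_le (hw : ∀ i, 0 ≤ w i) (f g : X → ℝ) :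
    discreteNorm w x (f + g) ≤ discreteNorm w x f + discreteNorm w x g := by
  simp only [discreteNorm_eq_norm hw]
  refine le_of_eq_of_le ?_ (norm_add_le _ _)
  congr 1
  ext i
  simp [mul_add]

theorem discreteNorm_neg (f : X → ℝ) : discreteNorm w x (-f) = discreteNorm w x f := by
  simp [discreteNorm]

theorem discreteNorm_sum_le {ι : Type*} (hw : ∀ i, 0 ≤ w i) (J : Finset ι) (f : ι → X → ℝ) :
    discreteNorm w x (∑ k ∈ J, f k) ≤ ∑ k ∈ J, discreteNorm w x (f k) := by
  classical
  induction J using Finset.induction_on with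
  | empty => simp [discreteNorm]
  | insert a J ha ih =>
    rw [Finset.sum_insert ha, Finset.sum_insert ha]
    exact (discreteNorm_add_le hw _ _).trans (by gcongr)

/-- Zero weights can be removed by splitting the weight of a point among several copies of it. -/
theorem exists_pos_weights (hw : ∀ i, 0 ≤ w i) (hne : ∃ i, w i ≠ 0) (x : Fin N → X) :
    ∃ (x' : Fin N → X) (w' : Fin N → ℝ), (∀ i, 0 < w' i) ∧
      ∀ h : X → ℝ, ∑ i, w' i * h (x' i) = ∑ i, w i * h (x i) := by
  classical
  obtain ⟨i₀, hi₀⟩ := hne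
  have hpos : 0 < w i₀ := (hw i₀).lt_of_ne' hi₀
  set z : ℕ := (Finset.univ.filter fun i => w i = 0).card with hz
  set c : ℝ := w i₀ / (z + 1) with hc
  have hc0 : 0 < c := by positivity
  refine ⟨fun i => if w i = 0 then x i₀ else x i,
    fun i => if w i = 0 ∨ i = i₀ then c else w i, fun i => ?_, fun h => ?_⟩
  · dsimp only
    split_ifs with hi
    · exact hc0
    · push Not at hi
      exact (hw i).lt_of_ne' hi.1
  · have key : ∀ i, (if w i = 0 ∨ i = i₀ then c else w i) *
        h (if w i = 0 then x i₀ else x i) =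
        w i * h (x i) + (if w i = 0 then c * h (x i₀) else 0) +
          (if i = i₀ then (c - w i₀) * h (x i₀) else 0) := by
      intro i
      by_cases h1 : w i = 0
      · have h2 : i ≠ i₀ := by rintro rfl; exact hi₀ h1
        simp [h1, h2]
      · by_cases h2 : i = i₀
        · subst h2
          simp [h1]
          ring
        · simp [h1, h2]
    rw [Finset.sum_congr rfl fun i _ => key i, Finset.sum_add_distrib, Finset.sum_add_distrib,
      ← Finset.sum_filter, Finset.sum_const, ← hz, Finset.sum_ite_eq']
    have : ((z : ℝ) + 1) * c = w i₀ := by rw [hc]; field_simp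
    simp only [Finset.mem_univ, if_true, nsmul_eq_mul]
    linear_combination h (x i₀) * this

end DiscreteNorm

section Chaining

open Filter

variable {X : Type*} [TopologicalSpace X] [CompactSpace X] [MeasurableSpace X] [BorelSpace X]
  [SecondCountableTopology X] (μ : Measure X) [IsProbabilityMeasure μ]
  (U : ℕ → Submodule ℝ C(X, ℝ)) {n : ℕ} {θ : ℕ → ℝ} {Θ r : ℝ}

theorem finrank_span_singleton_le_one {E : Type*} [AddCommGroup E] [Module ℝ E] (v : E) :
    Module.finrank ℝ (Submodule.span ℝ {v}) ≤ 1 :=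
  (finrank_span_le_card ({v} : Set E)).trans (by simp)

theorem sum_one_div_mul_succ_le (K : ℕ) :
    ∑ k : Fin K, (1 : ℝ) / (16 * ((k + 1) * (k + 2))) ≤ 1 / 16 := by
  rw [Fin.sum_univ_eq_sum_range (fun k => (1 : ℝ) / (16 * ((k + 1) * (k + 2))))]
  have : ∀ K : ℕ, ∑ k ∈ Finset.range K, (1 : ℝ) / (16 * ((k + 1) * (k + 2))) =
      1 / 16 - 1 / (16 * (K + 1)) := by
    intro K
    induction K with
    | zero => simp
    | succ K ih =>
      rw [Finset.sum_range_succ, ih]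
      push_cast
      field_simp
      ring
  rw [this]
  have : (0 : ℝ) ≤ 1 / (16 * (K + 1)) := by positivity
  linarith

omit [SecondCountableTopology X] in
theorem norm_toL2_one : ‖toL2 μ (1 : C(X, ℝ))‖ = 1 := by
  rw [← sq_eq_sq₀ (norm_nonneg _) zero_le_one, ← real_inner_self_eq_norm_sq,
    ContinuousMap.inner_toLp]
  simp

/-- A common discretization for finitely many functions, given approximants on dyadic levels. -/
theorem exists_points_of_finite (hn : 1 ≤ n) (hU : ∀ k, Module.finrank ℝ (U k) = 2 ^ k * n)
    (hr : 0 < r) (hθ : Tendsto θ atTop (nhds 0))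
    (hΘ : ∀ K, ∑ k ∈ Finset.range K, √2 ^ k * (k + 2) * (θ k + θ (k + 1)) ≤ Θ)
    {J : Type*} [Fintype J] (f : J → C(X, ℝ)) (g : J → ℕ → C(X, ℝ))
    (hg : ∀ j k, g j k ∈ U k) (hfg : ∀ j k, ‖toL2 μ (f j - g j k)‖ ≤ θ k * r) :
    ∃ (x : Fin (10 * n) → X) (w : Fin (10 * n) → ℝ), (∀ i, 0 < w i) ∧
      (∑ i, w i ≤ 16 * (1 + 10 * n)) ∧
      (∀ h ∈ U 0 ⊔ Submodule.span ℝ {1}, 2 * n * ‖toL2 μ h‖ ^ 2 ≤ ∑ i, w i * h (x i) ^ 2) ∧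
      ∀ j, discreteNorm w x (f j - g j 0) ≤ (√208 * Θ + 1) * √n * r := by
  have hn' : (1 : ℝ) ≤ n := by exact_mod_cast hn
  have hfin : ∀ k, FiniteDimensional ℝ (U k) := fun k =>
    Module.finite_of_finrank_pos (by rw [hU]; positivity)
  set q : ℝ := Fintype.card J + 1 with hq
  have hq0 : 0 < q := by positivity
  obtain ⟨K, hK⟩ : ∃ K, θ K < √n / √(16 * q * (1 + 10 * n)) :=
    ((tendsto_order.1 hθ).2 _ (by positivity)).exists
  let W : Fin K ⊕ J ⊕ Unit → Submodule ℝ C(X, ℝ) :=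
    Sum.elim (fun k => U k ⊔ U (k + 1))
      (Sum.elim (fun j => Submodule.span ℝ {f j - g j K}) fun _ => Submodule.span ℝ {1})
  let m : Fin K ⊕ J ⊕ Unit → ℕ := Sum.elim (fun k => 3 * 2 ^ (k : ℕ) * n) fun _ => 1
  let p : Fin K ⊕ J ⊕ Unit → ℝ :=
    Sum.elim (fun k => 1 / (16 * ((k + 1) * (k + 2))))
      (Sum.elim (fun _ => 1 / (16 * q)) fun _ => 1 / 16)
  have hWfin : ∀ k, FiniteDimensional ℝ (W k) := by
    rintro (k | j | u)
    · exact Submodule.finiteDimensional_sup (U k) (U (k + 1))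
    · exact FiniteDimensional.span_singleton ℝ (f j - g j K)
    · exact FiniteDimensional.span_singleton ℝ (1 : C(X, ℝ))
  have hm0 : ∀ k, 0 < m k := by
    rintro (k | j) <;> simp only [m, Sum.elim_inl, Sum.elim_inr] <;> positivity
  have hm : ∀ k, Module.finrank ℝ (W k) ≤ m k := by
    rintro (k | j | u) <;> simp only [m, W, Sum.elim_inl, Sum.elim_inr]
    · refine (Submodule.finrank_add_le_finrank_add_finrank _ _).trans ?_
      rw [hU, hU, pow_succ]
      linarith
    · exact finrank_span_singleton_le_one _
    · exact finrank_span_singleton_le_one _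
  have hp : ∀ k, 0 < p k := by
    rintro (k | j | u) <;> simp only [p, Sum.elim_inl, Sum.elim_inr] <;> positivity
  have hsum : ∑ k, p k < 3 / 8 := by
    simp only [p, Fintype.sum_sum_type, Sum.elim_inl, Sum.elim_inr, Finset.sum_const,
      Finset.card_univ, Fintype.card_unit, nsmul_eq_mul]
    have h1 := sum_one_div_mul_succ_le K
    have h2 : (Fintype.card J : ℝ) * (1 / (16 * q)) ≤ 1 / 16 := by
      rw [mul_one_div, div_le_div_iff₀ (by positivity) (by positivity)]
      linarith
    push_cast
    linarith
  have hV : Module.finrank ℝ ↥(U 0 ⊔ Submodule.span ℝ {(1 : C(X, ℝ))}) ≤ 2 * n := by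
    refine (Submodule.finrank_add_le_finrank_add_finrank _ _).trans ?_
    have := finrank_span_singleton_le_one (1 : C(X, ℝ))
    rw [hU]
    omega
  obtain ⟨x, w, -, hw, hlow, hup⟩ := exists_discretization μ (U 0 ⊔ Submodule.span ℝ {1})
    (Submodule.mem_sup_right (Submodule.mem_span_singleton_self _)) hV W hm0 hm hp hsum (10 * n)
  have hw' := fun i => (hw i).le
  refine ⟨x, w, hw, ?_, fun h hh => ?_, fun j => ?_⟩
  · have h1 := hup (Sum.inr (Sum.inr ())) 1 (Submodule.mem_span_singleton_self _)
    rw [norm_toL2_one] at h1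
    simp only [m, p, Sum.elim_inr, ContinuousMap.one_apply] at h1
    simp only [one_pow, mul_one, Nat.cast_one] at h1
    refine h1.trans (le_of_eq ?_)
    push_cast
    ring
  · have h1 := hlow h hh
    push_cast at h1
    linarith
  · have htel : (⇑(f j) - ⇑(g j 0) : X → ℝ) = (⇑(f j) - ⇑(g j K)) +
        ∑ k ∈ Finset.range K, (⇑(g j (k + 1)) - ⇑(g j k)) := by
      rw [Finset.sum_range_sub (fun k => (⇑(g j k) : X → ℝ))]
      abel
    have hlast : discreteNorm w x (f j - g j K) ≤ √n * r := by
      have h1 := hup (Sum.inr (Sum.inl j)) _ (Submodule.mem_span_singleton_self _)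
      simp only [m, p, Sum.elim_inr, Sum.elim_inl] at h1
      push_cast at h1
      have h2 : ‖toL2 μ (f j - g j K)‖ ≤ √n / √(16 * q * (1 + 10 * n)) * r :=
        (hfg j K).trans (by gcongr)
      refine Real.sqrt_le_iff.2 ⟨by positivity, h1.trans ?_⟩
      calc (1 + 10 * n : ℝ) / (1 / (16 * q)) * ‖toL2 μ (f j - g j K)‖ ^ 2
          ≤ (1 + 10 * n : ℝ) / (1 / (16 * q)) * (√n / √(16 * q * (1 + 10 * n)) * r) ^ 2 := by
            gcongr
        _ = (√n * r) ^ 2 := by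
            rw [mul_pow, div_pow, Real.sq_sqrt (by positivity : 0 ≤ 16 * q * (1 + 10 * (n : ℝ)))]
            field_simp
    have hlevel : ∀ k ∈ Finset.range K, discreteNorm w x (g j (k + 1) - g j k) ≤
        √208 * √n * r * (√2 ^ k * (k + 2) * (θ k + θ (k + 1))) := by
      intro k hk
      have h1 := hup (Sum.inl ⟨k, Finset.mem_range.1 hk⟩) (g j (k + 1) - g j k)
        (Submodule.sub_mem _ (Submodule.mem_sup_right (hg j (k + 1)))
          (Submodule.mem_sup_left (hg j k)))
      simp only [m, p, Sum.elim_inl] at h1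
      push_cast at h1
      have h2 : ‖toL2 μ (g j (k + 1) - g j k)‖ ≤ (θ k + θ (k + 1)) * r := by
        have e : g j (k + 1) - g j k = (f j - g j k) - (f j - g j (k + 1)) := by abel
        rw [e, map_sub]
        refine (norm_sub_le _ _).trans ?_
        linarith [hfg j k, hfg j (k + 1)]
      have hθθ : 0 ≤ θ k + θ (k + 1) := by
        have := (norm_nonneg _).trans h2
        exact nonneg_of_mul_nonneg_left this hr
      refine Real.sqrt_le_iff.2 ⟨by positivity, h1.trans ?_⟩
      have h3 : (3 * 2 ^ k * n + 10 * n : ℝ) / (1 / (16 * ((k + 1) * (k + 2)))) ≤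
          208 * n * 2 ^ k * (k + 2) ^ 2 := by
        have h4 : (1 : ℝ) ≤ 2 ^ k := one_le_pow₀ (by norm_num)
        rw [div_div_eq_mul_div, div_one]
        calc (3 * 2 ^ k * n + 10 * n : ℝ) * (16 * ((k + 1) * (k + 2)))
            ≤ (3 * 2 ^ k * n + 10 * n * 2 ^ k) * (16 * ((k + 2) * (k + 2))) := by
              have h5 : (10 * n : ℝ) ≤ 10 * n * 2 ^ k :=
                le_mul_of_one_le_right (by positivity) h4
              refine mul_le_mul (by linarith) ?_ (by positivity) (by positivity)
              gcongr
              norm_num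
          _ = _ := by ring
      calc _ ≤ 208 * n * 2 ^ k * (k + 2) ^ 2 * ((θ k + θ (k + 1)) * r) ^ 2 := by gcongr
        _ = _ := by
          simp only [mul_pow]
          rw [Real.sq_sqrt (by positivity), Real.sq_sqrt (by positivity), ← pow_mul, mul_comm k,
            pow_mul, Real.sq_sqrt (by positivity)]
          ring
    rw [htel]
    calc _ ≤ discreteNorm w x (f j - g j K) +
          ∑ k ∈ Finset.range K, discreteNorm w x (g j (k + 1) - g j k) :=
          (discreteNorm_add_le hw' _ _).trans
            (add_le_add (le_refl _) (discreteNorm_sum_le hw' _ _))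
      _ ≤ √n * r + √208 * √n * r * Θ := by
          refine add_le_add hlast ((Finset.sum_le_sum hlevel).trans ?_)
          rw [← Finset.mul_sum]
          exact mul_le_mul_of_nonneg_left (hΘ K) (by positivity)
      _ = _ := by ring

/-- A common discretization for arbitrarily many functions, given approximants on dyadic levels. -/
theorem exists_points (hn : 1 ≤ n) (hU : ∀ k, Module.finrank ℝ (U k) = 2 ^ k * n)
    (hr : 0 < r) (hθ : Tendsto θ atTop (nhds 0))
    (hΘ : ∀ K, ∑ k ∈ Finset.range K, √2 ^ k * (k + 2) * (θ k + θ (k + 1)) ≤ Θ)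
    {J : Type*} (f : J → C(X, ℝ)) (g : J → ℕ → C(X, ℝ))
    (hg : ∀ j k, g j k ∈ U k) (hfg : ∀ j k, ‖toL2 μ (f j - g j k)‖ ≤ θ k * r) :
    ∃ (x : Fin (10 * n) → X) (w : Fin (10 * n) → ℝ), (∀ i, 0 < w i) ∧
      (∀ h ∈ U 0, 2 * n * ‖toL2 μ h‖ ^ 2 ≤ ∑ i, w i * h (x i) ^ 2) ∧
      ∀ j, discreteNorm w x (f j - g j 0) ≤ (√208 * Θ + 1) * √n * r := by
  have hcont : ∀ h : C(X, ℝ), Continuous fun y : (Fin (10 * n) → X) × (Fin (10 * n) → ℝ) =>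
      ∑ i, y.2 i * h (y.1 i) ^ 2 := fun h => by fun_prop
  let S : Set ((Fin (10 * n) → X) × (Fin (10 * n) → ℝ)) :=
    (Set.univ ×ˢ Set.univ.pi fun _ => Set.Icc (0 : ℝ) (16 * (1 + 10 * n))) ∩
      {y | ∀ h ∈ U 0 ⊔ Submodule.span ℝ {1},
        2 * n * ‖toL2 μ h‖ ^ 2 ≤ ∑ i, y.2 i * h (y.1 i) ^ 2}
  have hS : IsCompact S := by
    refine (isCompact_univ.prod (isCompact_univ_pi fun _ => isCompact_Icc)).inter_right ?_
    simp only [Set.ofPred_forall]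
    exact isClosed_iInter fun h => isClosed_iInter fun _ => isClosed_le continuous_const (hcont h)
  let t : J → Set ((Fin (10 * n) → X) × (Fin (10 * n) → ℝ)) := fun j =>
    {y | discreteNorm y.2 y.1 (f j - g j 0) ≤ (√208 * Θ + 1) * √n * r}
  have ht : ∀ j, IsClosed (t j) := fun j =>
    isClosed_le (hcont (f j - g j 0)).sqrt continuous_const
  obtain ⟨⟨x, w⟩, ⟨⟨-, hw⟩, hlow⟩, hup⟩ := hS.inter_iInter_nonempty t ht fun u => by
    obtain ⟨x, w, hw, hsum, hlow, hup⟩ := exists_points_of_finite μ U hn hU hr hθ hΘ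
      (fun j : u => f j) (fun j : u => g j) (fun j => hg j) fun j => hfg j
    refine ⟨(x, w), ⟨⟨Set.mem_univ _, fun i _ => ⟨(hw i).le, ?_⟩⟩, hlow⟩,
      Set.mem_iInter₂.2 fun j hj => hup ⟨j, hj⟩⟩
    exact (Finset.single_le_sum (fun i _ => (hw i).le) (Finset.mem_univ i)).trans hsum
  have hne : ∃ i, w i ≠ 0 := by
    by_contra! h0
    have h1 := hlow 1 (Submodule.mem_sup_right (Submodule.mem_span_singleton_self _))
    rw [norm_toL2_one] at h1
    have hn' : (1 : ℝ) ≤ n := by exact_mod_cast hn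
    simp only [h0, zero_mul, Finset.sum_const_zero] at h1
    linarith
  obtain ⟨x', w', hw', hsum⟩ := exists_pos_weights (fun i => (hw i (Set.mem_univ i)).1) hne x
  refine ⟨x', w', hw', fun h hh => ?_, fun j => ?_⟩
  · rw [hsum fun y => h y ^ 2]
    exact hlow h (Submodule.mem_sup_left hh)
  · rw [discreteNorm, hsum fun y => (⇑(f j) - ⇑(g j 0)) y ^ 2]
    exact Set.mem_iInter.1 hup j

end Chaining

section LeastSquares

variable {X : Type*} [TopologicalSpace X] [CompactSpace X] [MeasurableSpace X] [BorelSpace X]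
  {μ : Measure X} [IsFiniteMeasure μ] {N : ℕ} {w : Fin N → ℝ} {x : Fin N → X}

theorem norm_sub_le_of_isMinOn_discreteNorm (hw : ∀ i, 0 ≤ w i) {W : Submodule ℝ C(X, ℝ)} {a : ℝ}
    (ha : 0 < a) (hlow : ∀ h ∈ W, a * ‖toL2 μ h‖ ^ 2 ≤ ∑ i, w i * h (x i) ^ 2)
    {f g g₀ : C(X, ℝ)} (hg₀ : g₀ ∈ W) (hg : g ∈ W)
    (hmin : discreteNorm w x (f - g) ≤ discreteNorm w x (f - g₀)) :
    √a * ‖toL2 μ (f - g)‖ ≤ √a * ‖toL2 μ (f - g₀)‖ + 2 * discreteNorm w x (f - g₀) := by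
  have h1 : √a * ‖toL2 μ (g₀ - g)‖ ≤ discreteNorm w x (g₀ - g) := by
    refine Real.le_sqrt_of_sq_le ?_
    rw [mul_pow, Real.sq_sqrt ha.le]
    exact hlow _ (W.sub_mem hg₀ hg)
  have h2 : discreteNorm w x (g₀ - g) ≤ discreteNorm w x (f - g) + discreteNorm w x (f - g₀) := by
    rw [← discreteNorm_neg (⇑f - ⇑g₀)]
    refine le_of_eq_of_le ?_ (discreteNorm_add_le hw _ _)
    congr 1
    abel
  have h3 : ‖toL2 μ (f - g)‖ ≤ ‖toL2 μ (f - g₀)‖ + ‖toL2 μ (g₀ - g)‖ := by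
    rw [← sub_add_sub_cancel f g₀ g, map_add]
    exact norm_add_le _ _
  nlinarith [mul_le_mul_of_nonneg_left h3 (Real.sqrt_nonneg a)]

theorem eLpNorm_sub_eq_ofReal_norm (f g : C(X, ℝ)) :
    eLpNorm (⇑f - ⇑g) 2 μ = ENNReal.ofReal ‖toL2 μ (f - g)‖ := by
  rw [Lp.norm_def, eLpNorm_congr_ae (ContinuousMap.coeFn_toLp (p := 2) (𝕜 := ℝ) μ (f - g)),
    ENNReal.ofReal_toReal, ContinuousMap.coe_sub]
  rw [← eLpNorm_congr_ae (ContinuousMap.coeFn_toLp (p := 2) (𝕜 := ℝ) μ (f - g))]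
  exact (Lp.memLp _).eLpNorm_ne_top

end LeastSquares

section Rate

open Filter

/-- The summability which makes dyadic chaining work when `α > 1 / 2`. -/
theorem tendsto_and_sum_dyadic_rate_le {α β : ℝ} (hα : 1 / 2 < α) (hβ : 0 < β) :
    Tendsto (fun k : ℕ => 2 * ((2 : ℝ) ^ (-α)) ^ k * (k + 1) ^ β) atTop (nhds 0) ∧
      ∃ Θ : ℝ, ∀ K, ∑ k ∈ Finset.range K, √2 ^ k * (k + 2) *
        (2 * ((2 : ℝ) ^ (-α)) ^ k * (k + 1) ^ β +
          2 * ((2 : ℝ) ^ (-α)) ^ (k + 1) * ((k + 1 : ℕ) + 1) ^ β) ≤ Θ := by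
  set a : ℝ := (2 : ℝ) ^ (-α) with ha
  have ha0 : 0 < a := by positivity
  have ha1 : a ≤ 1 := Real.rpow_le_one_of_one_le_of_nonpos (by norm_num) (by linarith)
  have h2 : 1 ≤ √2 := Real.one_le_sqrt.2 (by norm_num)
  have hρ1 : √2 * a < 1 := by
    rw [Real.sqrt_eq_rpow, ha, ← Real.rpow_add (by norm_num)]
    exact Real.rpow_lt_one_of_one_lt_of_neg (by norm_num) (by linarith)
  have hρ0 : 0 < √2 * a := by positivity
  obtain ⟨L, hL⟩ := exists_nat_ge (1 + β)
  have hpow : ∀ k : ℕ, (k + 2 : ℝ) * (k + 2) ^ β ≤ (k + 2) ^ L := by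
    intro k
    have h3 : (0 : ℝ) < k + 2 := by positivity
    rw [← Real.rpow_natCast, ← Real.rpow_one_add' h3.le (by linarith)]
    exact Real.rpow_le_rpow_of_exponent_le (by linarith) hL
  have hsum : Summable fun k : ℕ => 4 * (√2 * a) ^ k * (k + 2 : ℝ) ^ L := by
    have h4 : Summable fun m : ℕ => (m : ℝ) ^ L * (√2 * a) ^ m :=
      summable_pow_mul_geometric_of_norm_lt_one L (by rwa [Real.norm_of_nonneg hρ0.le])
    refine (((summable_nat_add_iff 2).2 h4).mul_left (4 / (√2 * a) ^ 2)).congr fun k => ?_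
    push_cast
    rw [pow_add]
    field_simp
  have hmono : ∀ k : ℕ, (k + 1 : ℝ) ^ β ≤ (k + 2) ^ β := fun k =>
    Real.rpow_le_rpow (by positivity) (by linarith) hβ.le
  have hterm : ∀ k : ℕ, √2 ^ k * (k + 2) * (2 * a ^ k * (k + 1) ^ β +
      2 * a ^ (k + 1) * ((k + 1 : ℕ) + 1) ^ β) ≤ 4 * (√2 * a) ^ k * (k + 2 : ℝ) ^ L := by
    intro k
    have h5 : a ^ (k + 1) ≤ a ^ k := pow_le_pow_of_le_one ha0.le ha1 (Nat.le_succ k)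
    have h6 : (((k + 1 : ℕ) : ℝ) + 1) = k + 2 := by push_cast; ring
    rw [h6]
    calc _ ≤ √2 ^ k * (k + 2) * (2 * a ^ k * (k + 2) ^ β + 2 * a ^ k * (k + 2 : ℝ) ^ β) := by
          gcongr
          linarith
      _ = 4 * (√2 * a) ^ k * ((k + 2 : ℝ) * (k + 2) ^ β) := by
          rw [mul_pow]
          ring
      _ ≤ _ := by
          gcongr
          exact hpow k
  refine ⟨squeeze_zero (fun k => by positivity) (fun k => ?_) hsum.tendsto_atTop_zero, _,
    fun K => (Finset.sum_le_sum fun k _ => hterm k).trans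
      (hsum.sum_le_tsum _ fun k _ => by positivity)⟩
  refine le_trans ?_ (hterm k)
  have h7 : 1 ≤ √2 ^ k * (k + 2) :=
    one_le_mul_of_one_le_of_one_le (one_le_pow₀ h2) (by linarith [k.cast_nonneg (α := ℝ)])
  refine (le_mul_of_one_le_left (by positivity) h7).trans ?_
  gcongr
  exact le_add_of_nonneg_right (by positivity)

theorem two_pow_mul_rpow_mul_log_rpow_le {α β : ℝ} (hβ : 0 < β) {n : ℕ} (hn : 2 ≤ n) (k : ℕ) :
    ((2 ^ k * n : ℕ) : ℝ) ^ (-α) * Real.log (2 ^ k * n : ℕ) ^ β ≤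
      ((2 : ℝ) ^ (-α)) ^ k * (k + 1) ^ β * ((n : ℝ) ^ (-α) * Real.log n ^ β) := by
  have hn' : (2 : ℝ) ≤ n := by exact_mod_cast hn
  have hlog : 0 < Real.log n := Real.log_pos (by linarith)
  have h1 : Real.log (2 ^ k * n : ℕ) ≤ (k + 1) * Real.log n := by
    push_cast
    rw [Real.log_mul (by positivity) (by positivity), Real.log_pow, add_mul, one_mul]
    gcongr
  have h2 : ((2 ^ k * n : ℕ) : ℝ) ^ (-α) = ((2 : ℝ) ^ (-α)) ^ k * (n : ℝ) ^ (-α) := by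
    push_cast
    rw [Real.mul_rpow (by positivity) (by positivity), ← Real.rpow_natCast_mul (by positivity),
      ← Real.rpow_mul_natCast (by positivity), mul_comm (k : ℝ)]
  have h3 : 0 ≤ Real.log (2 ^ k * n : ℕ) := Real.log_natCast_nonneg _
  calc _ ≤ ((2 : ℝ) ^ (-α)) ^ k * (n : ℝ) ^ (-α) * ((k + 1) * Real.log n) ^ β := by
        rw [h2]
        gcongr
    _ = _ := by
        rw [Real.mul_rpow (by positivity) hlog.le]
        ring

end Rate

/-- weighted least squares achieves the best-approximation rate in
`L_2` with linear oversampling: for all `α > 1/2`, `β, C > 0` there are `b ∈ ℕ`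
and `c > 0` such that whenever `μ` is a Borel probability measure on a compact
`D ⊆ ℝ^d`, `(V_n)` are `n`-dimensional subspaces of `C(D)` and `F ⊆ C(D)` satisfies
`sup_{f∈F} inf_{g∈V_n} ‖f−g‖_{L_2(μ)} ≤ C·n^{−α}(log n)^β` for all `n ≥ 2`, then for
every `n ≥ 2` there are points `x_1,…,x_{bn} ∈ D` and weights `w_i > 0` such that
every weighted least squares minimizer `g* ∈ V_n` of every `f ∈ F` satisfies
`‖f − g*‖_{L_2(μ)} ≤ c·n^{−α}(log n)^β`. -/
theorem weighted_least_squares_L2_rate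
    (α β C : ℝ) (hα : 1 / 2 < α) (hβ : 0 < β) (hC : 0 < C) :
    ∃ b : ℕ, ∃ c : ℝ, 0 < c ∧
      ∀ (d : ℕ) (D : Set (Fin d → ℝ)), IsCompact D →
        ∀ μ : Measure D, IsProbabilityMeasure μ →
          ∀ V : ℕ → Submodule ℝ C(D, ℝ), (∀ n, Module.finrank ℝ (V n) = n) →
            ∀ F : Set C(D, ℝ),
              (∀ n : ℕ, 2 ≤ n → ∀ f ∈ F,
                sInf {r : ℝ | ∃ g ∈ V n, r = (eLpNorm (⇑f - ⇑g) 2 μ).toReal} ≤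
                  C * (n : ℝ) ^ (-α) * Real.log n ^ β) →
              ∀ n : ℕ, 2 ≤ n →
                ∃ (x : Fin (b * n) → D) (w : Fin (b * n) → ℝ),
                  (∀ i, 0 < w i) ∧
                  ∀ f ∈ F, ∀ g ∈ V n,
                    (∀ h ∈ V n,
                      ∑ i, w i * |f (x i) - g (x i)| ^ 2 ≤
                        ∑ i, w i * |f (x i) - h (x i)| ^ 2) →
                    eLpNorm (⇑f - ⇑g) 2 μ ≤
                      ENNReal.ofReal (c * (n : ℝ) ^ (-α) * Real.log n ^ β) := by
  obtain ⟨hθ, Θ, hΘ⟩ := tendsto_and_sum_dyadic_rate_le hα hβ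
  have hΘ0 : 0 ≤ Θ := by simpa using hΘ 0
  refine ⟨10, (2 + 2 * (√208 * Θ + 1)) * C, by positivity, ?_⟩
  intro d D hD μ hμ V hV F hF n hn
  have : CompactSpace D := isCompact_iff_compactSpace.1 hD
  have hn' : (2 : ℝ) ≤ n := by exact_mod_cast hn
  have hlog : ∀ m : ℕ, 2 ≤ m → 0 < C * (m : ℝ) ^ (-α) * Real.log m ^ β := fun m hm => by
    have hm' : (2 : ℝ) ≤ m := by exact_mod_cast hm
    have := Real.log_pos (by linarith : (1 : ℝ) < m)
    positivity
  set r : ℝ := C * (n : ℝ) ^ (-α) * Real.log n ^ β with hr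
  have hr0 : 0 < r := hlog n hn
  have happrox : ∀ (f : F) (k : ℕ), ∃ g ∈ V (2 ^ k * n),
      ‖toL2 μ (f - g)‖ ≤ 2 * ((2 : ℝ) ^ (-α)) ^ k * (k + 1) ^ β * r := by
    intro f k
    have hm : 2 ≤ 2 ^ k * n := hn.trans (Nat.le_mul_of_pos_left n (by positivity))
    have hm0 := hlog _ hm
    obtain ⟨_, ⟨g, hg, rfl⟩, hlt⟩ := exists_lt_of_csInf_lt (⟨_, 0, zero_mem _, rfl⟩ :
        {r : ℝ | ∃ g ∈ V (2 ^ k * n), r = (eLpNorm (⇑f.1 - ⇑g) 2 μ).toReal}.Nonempty)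
      ((hF _ hm f f.2).trans_lt (lt_two_mul_self hm0))
    rw [eLpNorm_sub_eq_ofReal_norm, ENNReal.toReal_ofReal (norm_nonneg _)] at hlt
    refine ⟨g, hg, hlt.le.trans ?_⟩
    have := mul_le_mul_of_nonneg_left (two_pow_mul_rpow_mul_log_rpow_le (α := α) hβ hn k) hC.le
    rw [hr]
    linarith
  choose g hgV hgr using happrox
  obtain ⟨x, w, hw, hlow, hup⟩ := exists_points μ (fun k => V (2 ^ k * n)) (by omega)
    (fun k => hV _) hr0 hθ hΘ (fun f : F => f.1) g hgV hgr
  simp only [pow_zero, one_mul] at hlow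
  refine ⟨x, w, hw, fun f hf h hh hmin => ?_⟩
  have hg0 : g ⟨f, hf⟩ 0 ∈ V n := by simpa using hgV ⟨f, hf⟩ 0
  have h0 := hgr ⟨f, hf⟩ 0
  have h1 := norm_sub_le_of_isMinOn_discreteNorm (f := f) (fun i => (hw i).le)
    (by positivity : (0 : ℝ) < 2 * n) hlow hg0 hh (Real.sqrt_le_sqrt (by
      simpa only [sq_abs, Pi.sub_apply] using hmin _ hg0))
  have h2 := hup ⟨f, hf⟩
  rw [eLpNorm_sub_eq_ofReal_norm]
  refine ENNReal.ofReal_le_ofReal ?_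
  simp only [pow_zero, mul_one, Nat.cast_zero, zero_add, Real.one_rpow] at h0
  have hs : √(n : ℝ) ≤ √(2 * n) := Real.sqrt_le_sqrt (by linarith)
  have hs0 : 0 < √(2 * (n : ℝ)) := by positivity
  have h3 : (√208 * Θ + 1) * √n * r ≤ √(2 * n) * ((√208 * Θ + 1) * r) := by
    have := mul_le_mul_of_nonneg_right hs (by positivity : 0 ≤ (√208 * Θ + 1) * r)
    linarith
  have h4 : √(2 * n) * ‖toL2 μ (f - h)‖ ≤ √(2 * n) * (2 * r + 2 * ((√208 * Θ + 1) * r)) := by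
    have := mul_le_mul_of_nonneg_left h0 hs0.le
    linarith
  refine (le_of_mul_le_mul_left h4 hs0).trans (le_of_eq ?_)
  rw [hr]
  ring
end
end
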